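/- A general cubic fourfold apolar to a Veronese surface cannot be written as a sum of 9 cubes of linear forms. Precisely: there exists a nonzero polynomial function P on the 28-dimensional space of sextic forms in 3 variables such that for every sextic g with P(g) ≠ 0, there are no vectors a₁, …, a₉ ∈ ℂ⁶ with s(g) = Σᵢ₌₁⁹ (aᵢ·x)³. (Consequence of Proposition \ref{lefiniteveronese}(i) of the paper: a general cubic fourfold apolar to a Veronese surface has cactus rank 10, hence no length-9 subscheme — in particular no 9-point set — is apolar to it.) -/

import Mathlib

open MvPolynomial

/-- The constant-coefficient differential operator associated with the monomial
exponent `d`: the composition over `i` of `(∂/∂xᵢ)^(d i)`. -/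
noncomputable def monOp {n : ℕ} (d : Fin n →₀ ℕ) :
    Module.End ℂ (MvPolynomial (Fin n) ℂ) :=
  (List.ofFn fun i : Fin n =>
    ((pderiv (R := ℂ) i).toLinearMap : Module.End ℂ (MvPolynomial (Fin n) ℂ)) ^ (d i)).prod

/-- The apolarity action `g ∘ f` : apply `g`, viewed as a constant-coefficient
differential operator, to `f`. -/
noncomputable def apolar {n : ℕ} (g f : MvPolynomial (Fin n) ℂ) :
    MvPolynomial (Fin n) ℂ :=
  ∑ d ∈ g.support, coeff d g • monOp d f

/-- The apolarity pairing `⟨f, k⟩ := k ∘ f` (its constant term). -/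
noncomputable def pairing {n : ℕ} (f k : MvPolynomial (Fin n) ℂ) : ℂ :=
  eval (fun _ => (0 : ℂ)) (apolar k f)

/-- The linear form `Σ vᵢ xᵢ` associated with a vector `v`. -/
noncomputable def linForm {n : ℕ} (v : Fin n → ℂ) : MvPolynomial (Fin n) ℂ :=
  ∑ i, MvPolynomial.C (v i) * X i

/-- The directional partial derivative `∂_v f = Σ vᵢ ∂f/∂xᵢ`. -/
noncomputable def pdir {n : ℕ} (v : Fin n → ℂ) (f : MvPolynomial (Fin n) ℂ) :
    MvPolynomial (Fin n) ℂ :=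
  ∑ i, MvPolynomial.C (v i) * pderiv i f

/-- The Veronese map `ν : ℂ³ → ℂ⁶`. -/
noncomputable def nu (w : Fin 3 → ℂ) : Fin 6 → ℂ :=
  ![w 0 ^ 2, 2 * w 0 * w 1, 2 * w 0 * w 2, w 1 ^ 2, 2 * w 1 * w 2, w 2 ^ 2]

/-- The components of the Veronese map as quadratic forms in `y₀, y₁, y₂`. -/
noncomputable def nuPoly : Fin 6 → MvPolynomial (Fin 3) ℂ :=
  ![X 0 ^ 2, 2 * X 0 * X 1, 2 * X 0 * X 2, X 1 ^ 2, 2 * X 1 * X 2, X 2 ^ 2]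

/-- A quadratic form `q` in 6 variables has rank `≤ r`: there is a symmetric matrix
`M` of rank `≤ r` with `q(x) = xᵀ M x`. -/
def QuadRankLe (q : MvPolynomial (Fin 6) ℂ) (r : ℕ) : Prop :=
  ∃ M : Matrix (Fin 6) (Fin 6) ℂ, M.IsSymm ∧ M.rank ≤ r ∧
    ∀ x : Fin 6 → ℂ, eval x q = ∑ i, ∑ j, M i j * x i * x j

/-- `s` is the linear map carrying a ternary sextic `g` to the cubic `s(g)` in six
variables, characterized by `⟨s(g), k⟩ = ⟨g, m(k)⟩` for all cubic forms `k`, where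
`m(k) = k ∘ ν`. -/
def IsSMap (s : MvPolynomial (Fin 3) ℂ →ₗ[ℂ] MvPolynomial (Fin 6) ℂ) : Prop :=
  (∀ g : MvPolynomial (Fin 3) ℂ, g.IsHomogeneous 6 → (s g).IsHomogeneous 3) ∧
  ∀ g : MvPolynomial (Fin 3) ℂ, ∀ k : MvPolynomial (Fin 6) ℂ,
    g.IsHomogeneous 6 → k.IsHomogeneous 3 →
      pairing (s g) k = pairing g (aeval nuPoly k)

/-- Evaluation of a polynomial function `P` in the coefficients at a polynomial `g`. -/
noncomputable def evalCoeff {σ : Type} (g : MvPolynomial σ ℂ) (P : MvPolynomial (σ →₀ ℕ) ℂ) : ℂ :=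
  eval (fun d => coeff d g) P

/-- The vanishing ideal of a subset of `ℂ⁵⁶`. -/
noncomputable def vanishingIdealOf (S : Set (Fin 56 → ℂ)) : Ideal (MvPolynomial (Fin 56) ℂ) :=
  ⨅ x ∈ S, RingHom.ker (eval x)

/-- An ideal is a prime ideal of height one: it is prime, admits a prime strictly
below it, and admits no chain of two primes strictly below it. -/
def IsHeightOnePrime {R : Type*} [CommRing R] (I : Ideal R) : Prop :=
  I.IsPrime ∧ (∃ p : Ideal R, p.IsPrime ∧ p < I) ∧
    ∀ p q : Ideal R, p.IsPrime → q.IsPrime → p < q → ¬ q < I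

/-- The space `Q_{f,U}` of quadratic forms vanishing on `U` and apolar to `f`. -/
def QfU (f : MvPolynomial (Fin 6) ℂ) (U : Submodule ℂ (Fin 6 → ℂ)) :
    Set (MvPolynomial (Fin 6) ℂ) :=
  {q | q.IsHomogeneous 2 ∧ (∀ u ∈ U, eval u q = 0) ∧ apolar q f = 0}

/-- The Zariski closure of a subset of `ℂ⁵⁶`. -/
def zcl (S : Set (Fin 56 → ℂ)) : Set (Fin 56 → ℂ) :=
  {x | ∀ P : MvPolynomial (Fin 56) ℂ, (∀ y ∈ S, eval y P = 0) → eval x P = 0}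

/-- The projection of a polynomial onto its squarefree monomials. -/
noncomputable def sqfreeProj (f : MvPolynomial (Fin 6) ℂ) : MvPolynomial (Fin 6) ℂ :=
  ∑ d ∈ f.support.filter (fun d => ∀ i, d i ≤ 1), monomial d (coeff d f)

open Module Matrix

section LinearRelations

variable {K V N ι : Type*} [Field K] [AddCommGroup V] [Module K V]
  [AddCommGroup N] [Module K N]

/-- Evaluation of linear functionals on a finite family of vectors. -/
def dualEvalFamily (b : ι → N) : Dual K N →ₗ[K] (ι → K) :=
  LinearMap.pi fun i => Dual.eval K N (b i)

theorem finrank_range_dualEvalFamily [FiniteDimensional K N] (b : ι → N) :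
    finrank K (dualEvalFamily (K := K) b).range = finrank K (Submodule.span K (Set.range b)) := by
  have hker : (dualEvalFamily (K := K) b).ker =
      (Submodule.span K (Set.range b)).dualAnnihilator := by
    ext β
    rw [LinearMap.mem_ker, Submodule.mem_dualAnnihilator]
    constructor
    · intro h w hw
      induction hw using Submodule.span_induction with
      | mem x hx => obtain ⟨i, rfl⟩ := hx; exact congrFun h i
      | zero => simp
      | add x y _ _ hx hy => simp [hx, hy]
      | smul c x _ hx => simp [hx]
    · intro h
      ext i
      exact h _ (Submodule.subset_span ⟨i, rfl⟩)
  have h1 := (dualEvalFamily (K := K) b).finrank_range_add_finrank_ker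
  have h2 := Subspace.finrank_add_finrank_dualAnnihilator_eq (Submodule.span K (Set.range b))
  rw [hker, Subspace.dual_finrank_eq] at h1
  omega

theorem finrank_span_add_finrank_ker [Fintype ι] (a : ι → V) :
    finrank K (Submodule.span K (Set.range a)) +
      finrank K (Fintype.linearCombination K a).ker = Fintype.card ι := by
  have h := (Fintype.linearCombination K a).finrank_range_add_finrank_ker
  rwa [Fintype.range_linearCombination, finrank_fintype_fun_eq_card] at h

theorem range_dualEvalFamily_le_ker [Fintype ι] {a : ι → V} {b : ι → N}
    (h : ∀ β : Dual K N, ∑ i, β (b i) • a i = 0) :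
    (dualEvalFamily (K := K) b).range ≤ (Fintype.linearCombination K a).ker := by
  rintro _ ⟨β, rfl⟩
  exact h β

theorem finrank_span_add_finrank_span_le [FiniteDimensional K N] [Fintype ι]
    {a : ι → V} {b : ι → N}
    (h : ∀ β : Dual K N, ∑ i, β (b i) • a i = 0) :
    finrank K (Submodule.span K (Set.range a)) + finrank K (Submodule.span K (Set.range b)) ≤
      Fintype.card ι := by
  rw [← finrank_span_add_finrank_ker (K := K) a, ← finrank_range_dualEvalFamily b]
  exact Nat.add_le_add_left (Submodule.finrank_mono (range_dualEvalFamily_le_ker h)) _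

/-- If the dimensions are extremal, every linear relation comes from a functional. -/
theorem exists_dual_of_relation [FiniteDimensional K N] [Fintype ι]
    {a : ι → V} {b : ι → N}
    (h : ∀ β : Dual K N, ∑ i, β (b i) • a i = 0)
    (hcard : Fintype.card ι ≤ finrank K (Submodule.span K (Set.range a)) +
      finrank K (Submodule.span K (Set.range b)))
    (κ : ι → K) (hκ : ∑ i, κ i • a i = 0) : ∃ β : Dual K N, ∀ i, κ i = β (b i) := by
  have heq := Submodule.eq_of_le_of_finrank_le (range_dualEvalFamily_le_ker h) (by
    have := finrank_span_add_finrank_ker (K := K) a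
    rw [finrank_range_dualEvalFamily]
    omega)
  have : κ ∈ (dualEvalFamily (K := K) b).range := by rw [heq]; exact hκ
  obtain ⟨β, rfl⟩ := this
  exact ⟨β, fun _ => rfl⟩

theorem exists_dual_apply_eq [Fintype ι] (a : ι → V) (y : ι → K)
    (h : ∀ κ : ι → K, ∑ i, κ i • a i = 0 → ∑ i, κ i * y i = 0) :
    ∃ q : Dual K V, ∀ i, q (a i) = y i := by
  classical
  have hmem : Fintype.linearCombination K y ∈ (Fintype.linearCombination K a).dualMap.range := by
    rw [LinearMap.range_dualMap_eq_dualAnnihilator_ker, Submodule.mem_dualAnnihilator]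
    intro κ hκ
    simpa [Fintype.linearCombination_apply] using h κ hκ
  obtain ⟨q, hq⟩ := hmem
  refine ⟨q, fun i => ?_⟩
  have := LinearMap.congr_fun hq (Pi.single i 1)
  simpa [Fintype.linearCombination_apply, Pi.single_apply] using this

theorem sum_subtype_smul_eq [Fintype ι] {a : ι → V} {b : ι → N} (I : Finset ι) (hb : ∀ i ∉ I, b i = 0)
    (h : ∀ β : Dual K N, ∑ i, β (b i) • a i = 0) (β : Dual K N) :
    ∑ i : I, β (b i) • a i = 0 := by
  rw [← h β, Finset.sum_coe_sort I (fun i => β (b i) • a i)]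
  exact Finset.sum_subset (Finset.subset_univ I) fun i _ hi => by simp [hb i hi]

theorem span_range_restrict {b : ι → N} (I : Finset ι) (hb : ∀ i ∉ I, b i = 0) :
    Submodule.span K (Set.range fun i : I => b i) = Submodule.span K (Set.range b) := by
  apply le_antisymm
  · apply Submodule.span_mono
    rintro _ ⟨i, rfl⟩
    exact ⟨i, rfl⟩
  · rw [Submodule.span_le]
    rintro _ ⟨i, rfl⟩
    by_cases hi : i ∈ I
    · exact Submodule.subset_span ⟨⟨i, hi⟩, rfl⟩
    · simp [hb i hi]

theorem finrank_span_restrict_add_le [FiniteDimensional K N] [Fintype ι]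
    {a : ι → V} {b : ι → N} (I : Finset ι)
    (hb : ∀ i ∉ I, b i = 0) (h : ∀ β : Dual K N, ∑ i, β (b i) • a i = 0) :
    finrank K (Submodule.span K (Set.range fun i : I => a i)) +
      finrank K (Submodule.span K (Set.range b)) ≤ I.card := by
  have := finrank_span_add_finrank_span_le (a := fun i : I => a i) (b := fun i : I => b i)
    (sum_subtype_smul_eq I hb h)
  rwa [span_range_restrict I hb, Fintype.card_coe] at this

end LinearRelations

section Veronese

/-- The symmetric matrix of a point of `ℂ⁶`, normalised so that `nu w` has matrix `w wᵀ`. -/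
noncomputable def symMat : (Fin 6 → ℂ) →ₗ[ℂ] Matrix (Fin 3) (Fin 3) ℂ where
  toFun a := !![a 0, a 1 / 2, a 2 / 2; a 1 / 2, a 3, a 4 / 2; a 2 / 2, a 4 / 2, a 5]
  map_add' a b := by ext i j; fin_cases i <;> fin_cases j <;> simp <;> ring
  map_smul' c a := by ext i j; fin_cases i <;> fin_cases j <;> simp <;> ring

theorem symMat_apply (a : Fin 6 → ℂ) :
    symMat a = !![a 0, a 1 / 2, a 2 / 2; a 1 / 2, a 3, a 4 / 2; a 2 / 2, a 4 / 2, a 5] := rfl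

theorem symMat_nu (w : Fin 3 → ℂ) : symMat (nu w) = vecMulVec w w := by
  ext i j
  fin_cases i <;> fin_cases j <;> simp [symMat_apply, nu, vecMulVec_apply] <;> ring

theorem symMat_transpose (a : Fin 6 → ℂ) : (symMat a)ᵀ = symMat a := by
  ext i j
  fin_cases i <;> fin_cases j <;> simp [symMat_apply]

theorem symMat_injective : Function.Injective symMat := by
  intro a b h
  have h' : ∀ i j, symMat a i j = symMat b i j := fun i j => by rw [h]
  have h0 := h' 0 0
  have h1 := h' 0 1
  have h2 := h' 0 2
  have h3 := h' 1 1
  have h4 := h' 1 2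
  have h5 := h' 2 2
  simp [symMat_apply] at h0 h1 h2 h3 h4 h5
  ext i
  fin_cases i <;> simp <;> grind

theorem nu_add_add_nu_sub (v w : Fin 3 → ℂ) :
    nu (w + v) + nu (w - v) = (2 : ℂ) • nu w + (2 : ℂ) • nu v := by
  ext i
  fin_cases i <;> simp [nu] <;> ring

theorem dual_eq_zero_of_nu {Q : Dual ℂ (Fin 6 → ℂ)} (h : ∀ v, Q (nu v) = 0) : Q = 0 := by
  have key : ∀ v, Q (nu v) = ∑ m, nu v m * Q (Pi.single m 1) := fun v => by
    conv_lhs => rw [← Finset.univ_sum_single (nu v), map_sum]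
    refine Finset.sum_congr rfl fun m _ => ?_
    rw [← smul_eq_mul, ← map_smul, ← Pi.single_smul, smul_eq_mul, mul_one]
  have h' : ∀ v, ∑ m, nu v m * Q (Pi.single m 1) = 0 := fun v => by rw [← key, h]
  have h0 := h' ![1, 0, 0]
  have h1 := h' ![1, 1, 0]
  have h2 := h' ![1, 0, 1]
  have h3 := h' ![0, 1, 0]
  have h4 := h' ![0, 1, 1]
  have h5 := h' ![0, 0, 1]
  simp [nu, Fin.sum_univ_six] at h0 h1 h2 h3 h4 h5
  refine LinearMap.pi_ext' fun m => LinearMap.ext_ring ?_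
  fin_cases m <;> simp <;> grind

theorem exists_dotProduct_ne_zero {n : ℕ} {u : Fin n → ℂ} (hu : u ≠ 0) : ∃ v, u ⬝ᵥ v ≠ 0 := by
  by_contra! h
  exact hu (dotProduct_eq_zero u h)

theorem exists_dotProduct_ne_zero_and {n : ℕ} {u x : Fin n → ℂ} (hu : u ≠ 0) (hx : x ≠ 0) :
    ∃ v, u ⬝ᵥ v ≠ 0 ∧ x ⬝ᵥ v ≠ 0 := by
  obtain ⟨v, hv⟩ := exists_dotProduct_ne_zero hu
  obtain ⟨w, hw⟩ := exists_dotProduct_ne_zero hx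
  by_cases h1 : x ⬝ᵥ v = 0
  · by_cases h2 : u ⬝ᵥ w = 0
    · exact ⟨v + w, by simp [dotProduct_add, h2, hv], by simp [dotProduct_add, h1, hw]⟩
    · exact ⟨w, h2, hw⟩
  · exact ⟨v, hv, h1⟩

theorem exists_nu_ne_zero_and {Q : Dual ℂ (Fin 6 → ℂ)} (hQ : Q ≠ 0) {u : Fin 3 → ℂ} (hu : u ≠ 0) :
    ∃ v, u ⬝ᵥ v ≠ 0 ∧ Q (nu v) ≠ 0 := by
  by_contra! h
  apply hQ
  apply dual_eq_zero_of_nu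
  intro w
  by_cases hw : u ⬝ᵥ w = 0
  · obtain ⟨v, hv⟩ := exists_dotProduct_ne_zero hu
    have h1 := h v hv
    have h2 := h (w + v) (by simpa [dotProduct_add, hw])
    have h3 := h (w - v) (by simpa [dotProduct_sub, hw])
    have h4 := congrArg Q (nu_add_add_nu_sub v w)
    simp only [map_add, map_smul, h1, h2, h3] at h4
    simpa using h4.symm
  · exact h w hw

theorem exists_nu_eq_of_adjugate_eq_zero {a : Fin 6 → ℂ} (h : adjugate (symMat a) = 0) :
    ∃ v, nu v = a := by
  have h' : ∀ i j, adjugate (symMat a) i j = 0 := fun i j => by rw [h]; rfl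
  have h00 := h' 0 0
  have h01 := h' 0 1
  have h02 := h' 0 2
  have h11 := h' 1 1
  have h12 := h' 1 2
  have h22 := h' 2 2
  simp [adjugate_fin_three, symMat_apply] at h00 h01 h02 h11 h12 h22
  by_cases h0 : a 0 = 0
  · by_cases h3 : a 3 = 0
    · obtain ⟨t, ht⟩ := IsAlgClosed.exists_pow_nat_eq (a 5) (n := 2) (by norm_num)
      refine ⟨![0, 0, t], ?_⟩
      ext i
      fin_cases i <;> simp [nu] <;> grind
    · obtain ⟨t, ht⟩ := IsAlgClosed.exists_pow_nat_eq (a 3) (n := 2) (by norm_num)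
      have ht0 : t ≠ 0 := by rintro rfl; simp at ht; exact h3 ht.symm
      refine ⟨![0, t, a 4 / (2 * t)], ?_⟩
      ext i
      fin_cases i <;> simp [nu] <;> (try field_simp) <;> grind
  · obtain ⟨t, ht⟩ := IsAlgClosed.exists_pow_nat_eq (a 0) (n := 2) (by norm_num)
    have ht0 : t ≠ 0 := by rintro rfl; simp at ht; exact h0 ht.symm
    refine ⟨![t, a 1 / (2 * t), a 2 / (2 * t)], ?_⟩
    ext i
    fin_cases i <;> simp [nu] <;> (try field_simp) <;> grind

/-- The coefficients that determine a linear map `θ` with `v ⬝ᵥ θ (nu v) = 0` for all `v`. -/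
def radicalCoords : ((Fin 6 → ℂ) →ₗ[ℂ] (Fin 3 → ℂ)) →ₗ[ℂ] (Fin 8 → ℂ) where
  toFun θ := ![θ (Pi.single 1 1) 0, θ (Pi.single 2 1) 0, θ (Pi.single 4 1) 0,
    θ (Pi.single 1 1) 1, θ (Pi.single 2 1) 1, θ (Pi.single 4 1) 1,
    θ (Pi.single 2 1) 2, θ (Pi.single 4 1) 2]
  map_add' θ η := by ext i; fin_cases i <;> simp
  map_smul' c θ := by ext i; fin_cases i <;> simp

theorem finrank_le_eight_of_radical (X : Submodule ℂ ((Fin 6 → ℂ) →ₗ[ℂ] (Fin 3 → ℂ)))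
    (hX : ∀ θ ∈ X, ∀ v, v ⬝ᵥ θ (nu v) = 0) : finrank ℂ X ≤ 8 := by
  have hinj : Function.Injective (radicalCoords.domRestrict X) := by
    rw [injective_iff_map_eq_zero]
    rintro ⟨θ, hθ⟩ h0
    have hc := hX θ hθ
    rw [Submodule.mk_eq_zero]
    have h1 : radicalCoords θ = 0 := h0
    have h2 : ∀ i, radicalCoords θ i = 0 := fun i => by rw [h1]; rfl
    have e0 := h2 0
    have e1 := h2 1
    have e2 := h2 2
    have e3 := h2 3
    have e4 := h2 4
    have e5 := h2 5
    have e6 := h2 6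
    have e7 := h2 7
    simp [radicalCoords] at e0 e1 e2 e3 e4 e5 e6 e7
    have key : ∀ v, θ (nu v) = ∑ m, nu v m • θ (Pi.single m 1) := fun v => by
      conv_lhs => rw [← Finset.univ_sum_single (nu v), map_sum]
      refine Finset.sum_congr rfl fun m _ => ?_
      rw [← map_smul, ← Pi.single_smul, smul_eq_mul, mul_one]
    have hv : ∀ v, v ⬝ᵥ (∑ m, nu v m • θ (Pi.single m 1)) = 0 := fun v => by rw [← key, hc]
    have c0 := hv ![1, 0, 0]
    have c1 := hv ![0, 1, 0]
    have c2 := hv ![0, 0, 1]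
    have c3 := hv ![1, 1, 0]
    have c4 := hv ![1, -1, 0]
    have c5 := hv ![1, 0, 1]
    have c6 := hv ![1, 0, -1]
    have c7 := hv ![0, 1, 1]
    have c8 := hv ![0, 1, -1]
    have c9 := hv ![1, 1, 1]
    simp [nu, Fin.sum_univ_six, dotProduct, Fin.sum_univ_three] at c0 c1 c2 c3 c4 c5 c6 c7 c8 c9
    refine LinearMap.pi_ext' fun m => LinearMap.ext_ring ?_
    ext p
    fin_cases m <;> fin_cases p <;> simp <;> grind
  have := LinearMap.finrank_le_finrank_of_injective hinj
  simpa using this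

end Veronese

section RigidFamily

/-- The properties of the points of a nine-term decomposition that lead to a contradiction:
the linear relations given by the adjugates of their matrices, and the nondegeneracy of the
underlying sextic. -/
structure IsRigidFamily (a : Fin 9 → Fin 6 → ℂ) : Prop where
  relation : ∀ β : Dual ℂ (Matrix (Fin 3) (Fin 3) ℂ), ∑ i, β (adjugate (symMat (a i))) • a i = 0
  rigid : ∀ θ : (Fin 6 → ℂ) →ₗ[ℂ] (Fin 3 → ℂ),
    (∀ m, ∑ i, a i m • (symMat (a i) *ᵥ θ (a i)) = 0) → ∀ v, v ⬝ᵥ θ (nu v) = 0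

namespace IsRigidFamily

variable {a : Fin 9 → Fin 6 → ℂ}

theorem radical (h : IsRigidFamily a) {θ : (Fin 6 → ℂ) →ₗ[ℂ] (Fin 3 → ℂ)}
    (hθ : ∀ i, symMat (a i) *ᵥ θ (a i) = 0) (v : Fin 3 → ℂ) : v ⬝ᵥ θ (nu v) = 0 :=
  h.rigid θ (fun m => by simp [hθ]) v

theorem dual_eq_zero (h : IsRigidFamily a) {u : Fin 3 → ℂ} (hu : u ≠ 0)
    {Q : Dual ℂ (Fin 6 → ℂ)} (hQ : ∀ i, symMat (a i) *ᵥ u ≠ 0 → Q (a i) = 0) : Q = 0 := by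
  by_contra hne
  obtain ⟨v, hv1, hv2⟩ := exists_nu_ne_zero_and hne hu
  have := h.radical (θ := Q.smulRight u) (fun i => by
    by_cases hi : symMat (a i) *ᵥ u = 0
    · simp [mulVec_smul, hi]
    · simp [hQ i hi]) v
  rw [LinearMap.smulRight_apply, dotProduct_smul, smul_eq_mul, dotProduct_comm] at this
  exact mul_ne_zero hv2 hv1 this

theorem span_eq_top (h : IsRigidFamily a) {u : Fin 3 → ℂ} (hu : u ≠ 0) (I : Finset (Fin 9))
    (hI : ∀ i ∉ I, symMat (a i) *ᵥ u = 0) :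
    Submodule.span ℂ (Set.range fun i : I => a i) = ⊤ := by
  by_contra hne
  obtain ⟨Q, hQ0, hQ⟩ := Submodule.exists_le_ker_of_lt_top _ (lt_top_iff_ne_top.2 hne)
  refine hQ0 (h.dual_eq_zero hu fun i hi => ?_)
  have hiI : i ∈ I := by
    by_contra hn
    exact hi (hI i hn)
  exact hQ (Submodule.subset_span ⟨⟨i, hiI⟩, rfl⟩)

theorem finrank_span (h : IsRigidFamily a) {u : Fin 3 → ℂ} (hu : u ≠ 0) (I : Finset (Fin 9))
    (hI : ∀ i ∉ I, symMat (a i) *ᵥ u = 0) :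
    finrank ℂ (Submodule.span ℂ (Set.range fun i : I => a i)) = 6 := by
  rw [h.span_eq_top hu I hI, finrank_top]
  simp

theorem not_proportional (h : IsRigidFamily a) (a0 : Fin 6 → ℂ)
    (hJ : ∀ i, adjugate (symMat (a i)) ≠ 0 → ∃ μ : ℂ, a i = μ • a0) : False := by
  have hex : ∀ i, ∃ (μ : ℂ) (v : Fin 3 → ℂ), (a i = μ • a0 ∧ adjugate (symMat (a i)) ≠ 0) ∨
      (a i = nu v ∧ μ = 0 ∧ adjugate (symMat (a i)) = 0) := fun i => by
    by_cases hi : adjugate (symMat (a i)) = 0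
    · obtain ⟨v, hv⟩ := exists_nu_eq_of_adjugate_eq_zero hi
      exact ⟨0, v, Or.inr ⟨hv.symm, rfl, hi⟩⟩
    · obtain ⟨μ, hμ⟩ := hJ i hi
      exact ⟨μ, 0, Or.inl ⟨hμ, hi⟩⟩
  choose μ v hμv using hex
  have hsum : ∑ i, μ i ^ 3 = 0 := by
    by_cases hall : ∀ i, adjugate (symMat (a i)) = 0
    · refine Finset.sum_eq_zero fun i _ => ?_
      rcases hμv i with hi | hi
      · exact absurd (hall i) hi.2
      · simp [hi.2.1]
    · push Not at hall
      obtain ⟨k, hk⟩ := hall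
      have hk' : a k = μ k • a0 := by
        rcases hμv k with hi | hi
        · exact hi.1
        · exact absurd hi.2.2 hk
      have hadj : adjugate (symMat a0) ≠ 0 := by
        intro h0
        apply hk
        rw [hk', map_smul, adjugate_smul, h0, smul_zero]
      have ha0 : a0 ≠ 0 := by
        rintro rfl
        simp [adjugate_zero] at hadj
      obtain ⟨β, hβ⟩ : ∃ β : Dual ℂ (Matrix (Fin 3) (Fin 3) ℂ), β (adjugate (symMat a0)) ≠ 0 := by
        by_contra! hc
        exact hadj ((Module.forall_dual_apply_eq_zero_iff ℂ _).1 hc)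
      have hrel := h.relation β
      have hterm : ∀ i, β (adjugate (symMat (a i))) • a i =
          μ i ^ 3 • (β (adjugate (symMat a0)) • a0) := fun i => by
        rcases hμv i with hi | hi
        · rw [hi.1, map_smul, adjugate_smul]
          simp only [Fintype.card_fin, map_smul, smul_smul, smul_eq_mul]
          congr 1
          ring
        · simp [hi.2.1, hi.2.2]
      simp only [hterm, ← Finset.sum_smul] at hrel
      rcases smul_eq_zero.1 hrel with h1 | h1
      · exact h1
      · rcases smul_eq_zero.1 h1 with h2 | h2
        · exact absurd h2 hβ
        · exact absurd h2 ha0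
  let Φ : ((Fin 6 → ℂ) →ₗ[ℂ] (Fin 3 → ℂ)) →ₗ[ℂ] (Fin 9 → ℂ) :=
    { toFun := fun θ i => v i ⬝ᵥ θ (nu (v i))
      map_add' := fun θ η => by ext i; simp [dotProduct_add]
      map_smul' := fun c θ => by ext i; simp [dotProduct_smul] }
  have hle := finrank_le_eight_of_radical Φ.ker (fun θ hθ w => by
    have hθ' : ∀ i, v i ⬝ᵥ θ (nu (v i)) = 0 := fun i => congrFun hθ i
    refine h.rigid θ (fun m => ?_) w
    have hterm : ∀ i, a i m • (symMat (a i) *ᵥ θ (a i)) =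
        μ i ^ 3 • (a0 m • (symMat a0 *ᵥ θ a0)) := fun i => by
      rcases hμv i with hi | hi
      · simp only [hi.1, map_smul, mulVec_smul, smul_mulVec, smul_smul, Pi.smul_apply, smul_eq_mul]
        congr 1
        ring
      · rw [hi.1, symMat_nu, vecMulVec_mulVec, hθ' i, hi.2.1]
        simp
    simp only [hterm, ← Finset.sum_smul, hsum, zero_smul])
  have hdim := Φ.finrank_range_add_finrank_ker
  have hr : finrank ℂ Φ.range ≤ 9 := by
    have := Submodule.finrank_le Φ.range
    simpa using this
  rw [Module.finrank_linearMap] at hdim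
  simp at hdim
  omega

end IsRigidFamily

end RigidFamily

section SymmetricMatrices

theorem exists_symMat_eq {M : Matrix (Fin 3) (Fin 3) ℂ} (hM : Mᵀ = M) : ∃ a, symMat a = M := by
  have h' : ∀ i j, M j i = M i j := fun i j => congrFun (congrFun hM i) j
  refine ⟨![M 0 0, 2 * M 0 1, 2 * M 0 2, M 1 1, 2 * M 1 2, M 2 2], ?_⟩
  ext i j
  fin_cases i <;> fin_cases j <;> simp [symMat_apply, h' 0 1, h' 0 2, h' 1 2]

theorem adjugate_symMat_transpose (a : Fin 6 → ℂ) :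
    (adjugate (symMat a))ᵀ = adjugate (symMat a) := by
  rw [adjugate_transpose, symMat_transpose]

theorem adjugate_adjugate_symMat (a : Fin 6 → ℂ) :
    adjugate (adjugate (symMat a)) = (symMat a).det • symMat a := by
  rw [adjugate_adjugate _ (by simp)]
  simp

theorem det_adjugate_symMat (a : Fin 6 → ℂ) :
    (adjugate (symMat a)).det = (symMat a).det ^ 2 := by
  rw [det_adjugate]
  simp

theorem vecMulVec_eq_zero_left {x u : Fin 3 → ℂ} (hu : u ≠ 0) (h : vecMulVec x u = 0) : x = 0 := by
  obtain ⟨j, hj⟩ := Function.ne_iff.1 hu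
  ext i
  have := congrFun (congrFun h i) j
  rw [vecMulVec_apply] at this
  exact (mul_eq_zero.1 this).resolve_right hj

/-- The adjugate of a symmetric matrix of rank two is the square of a kernel vector. -/
theorem exists_adjugate_eq_vecMulVec {a : Fin 6 → ℂ} (hdet : (symMat a).det = 0)
    (hadj : adjugate (symMat a) ≠ 0) :
    ∃ u, u ≠ 0 ∧ adjugate (symMat a) = vecMulVec u u ∧ symMat a *ᵥ u = 0 := by
  obtain ⟨b, hb⟩ := exists_symMat_eq (adjugate_symMat_transpose a)
  obtain ⟨u, hu⟩ := exists_nu_eq_of_adjugate_eq_zero (a := b) (by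
    rw [hb, adjugate_adjugate_symMat, hdet, zero_smul])
  rw [← hu, symMat_nu] at hb
  have hu0 : u ≠ 0 := by
    rintro rfl
    apply hadj
    rw [← hb]
    ext i j
    simp [vecMulVec_apply]
  refine ⟨u, hu0, hb.symm, ?_⟩
  have h1 := mul_adjugate (symMat a)
  rw [hdet, zero_smul, ← hb, mul_vecMulVec] at h1
  exact vecMulVec_eq_zero_left hu0 h1

theorem exists_basis_orthogonal {u : Fin 3 → ℂ} (hu : u ≠ 0) :
    ∃ w₁ w₂ f₁ f₂ : Fin 3 → ℂ, u ⬝ᵥ w₁ = 0 ∧ u ⬝ᵥ w₂ = 0 ∧ f₁ ⬝ᵥ w₁ = 1 ∧ f₁ ⬝ᵥ w₂ = 0 ∧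
      f₂ ⬝ᵥ w₁ = 0 ∧ f₂ ⬝ᵥ w₂ = 1 ∧
      ∀ v, u ⬝ᵥ v = 0 → v = (f₁ ⬝ᵥ v) • w₁ + (f₂ ⬝ᵥ v) • w₂ := by
  obtain ⟨j, hj⟩ := Function.ne_iff.1 hu
  simp only [Pi.zero_apply] at hj
  fin_cases j
  · simp at hj
    refine ⟨![-u 1 / u 0, 1, 0], ![-u 2 / u 0, 0, 1], ![0, 1, 0], ![0, 0, 1],
      ?_, ?_, ?_, ?_, ?_, ?_, fun v hv => ?_⟩
    on_goal 7 =>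
      simp [dotProduct, Fin.sum_univ_three] at hv
      ext i
      fin_cases i <;> simp [dotProduct, Fin.sum_univ_three] <;> (field_simp; grind)
    all_goals simp [dotProduct, Fin.sum_univ_three]
    all_goals field_simp
    all_goals ring
  · simp at hj
    refine ⟨![1, -u 0 / u 1, 0], ![0, -u 2 / u 1, 1], ![1, 0, 0], ![0, 0, 1],
      ?_, ?_, ?_, ?_, ?_, ?_, fun v hv => ?_⟩
    on_goal 7 =>
      simp [dotProduct, Fin.sum_univ_three] at hv
      ext i
      fin_cases i <;> simp [dotProduct, Fin.sum_univ_three] <;> (field_simp; grind)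
    all_goals simp [dotProduct, Fin.sum_univ_three]
    all_goals field_simp
    all_goals ring
  · simp at hj
    refine ⟨![1, 0, -u 0 / u 2], ![0, 1, -u 1 / u 2], ![1, 0, 0], ![0, 1, 0],
      ?_, ?_, ?_, ?_, ?_, ?_, fun v hv => ?_⟩
    on_goal 7 =>
      simp [dotProduct, Fin.sum_univ_three] at hv
      ext i
      fin_cases i <;> simp [dotProduct, Fin.sum_univ_three] <;> (field_simp; grind)
    all_goals simp [dotProduct, Fin.sum_univ_three]
    all_goals field_simp
    all_goals ring

/-- The bilinear form `xᵀ A y` of a symmetric matrix as a functional of the matrix. -/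
noncomputable def polarForm (x y : Fin 3 → ℂ) : Dual ℂ (Fin 6 → ℂ) where
  toFun a := x ⬝ᵥ (symMat a *ᵥ y)
  map_add' a b := by simp [add_mulVec, dotProduct_add]
  map_smul' c a := by simp [smul_mulVec, dotProduct_smul]

theorem polarForm_apply (x y : Fin 3 → ℂ) (a : Fin 6 → ℂ) :
    polarForm x y a = x ⬝ᵥ (symMat a *ᵥ y) := rfl

theorem polarForm_nu (x y v : Fin 3 → ℂ) : polarForm x y (nu v) = (x ⬝ᵥ v) * (y ⬝ᵥ v) := by
  rw [polarForm_apply, symMat_nu, vecMulVec_mulVec]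
  simp [dotProduct_smul, dotProduct_comm v y, mul_comm]

theorem three_le_finrank_of_nu_mem {u : Fin 3 → ℂ} (hu : u ≠ 0) (S : Submodule ℂ (Fin 6 → ℂ))
    (hS : ∀ w, u ⬝ᵥ w = 0 → nu w ∈ S) : 3 ≤ finrank ℂ S := by
  obtain ⟨w₁, w₂, f₁, f₂, h1, h2, h11, h12, h21, h22, -⟩ := exists_basis_orthogonal hu
  have hli : LinearIndependent ℂ ![nu w₁, nu w₂, nu (w₁ + w₂)] := by
    rw [Fintype.linearIndependent_iff]
    intro c hc
    have e (x y : Fin 3 → ℂ) := congrArg (polarForm x y) hc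
    simp only [Fin.sum_univ_three, map_add, map_smul, polarForm_nu, map_zero, smul_eq_mul,
      Matrix.cons_val, dotProduct_add] at e
    have e11 := e f₁ f₁
    have e12 := e f₁ f₂
    have e22 := e f₂ f₂
    simp [h11, h12, h21, h22] at e11 e12 e22
    intro i
    fin_cases i <;> simp <;> grind
  have hle : Submodule.span ℂ (Set.range ![nu w₁, nu w₂, nu (w₁ + w₂)]) ≤ S := by
    rw [Submodule.span_le]
    rintro _ ⟨i, rfl⟩
    fin_cases i
    · exact hS _ h1
    · exact hS _ h2
    · exact hS _ (by simp [dotProduct_add, h1, h2])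
  have := Submodule.finrank_mono hle
  rwa [finrank_span_eq_card hli, Fintype.card_fin] at this

end SymmetricMatrices

namespace IsRigidFamily

variable {a : Fin 9 → Fin 6 → ℂ}

theorem not_proportional_det_ne_zero (h : IsRigidFamily a) {b : Matrix (Fin 3) (Fin 3) ℂ}
    {c : Fin 9 → ℂ} (hb : ∀ i, adjugate (symMat (a i)) = c i • b) {k : Fin 9}
    (hk : adjugate (symMat (a k)) ≠ 0) : b.det = 0 := by
  by_contra hdet
  have hA : ∀ i, adjugate (symMat (a i)) ≠ 0 →
      ∃ e : ℂ, e ≠ 0 ∧ symMat (a i) = e • adjugate b := fun i hi => by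
    have hci : c i ≠ 0 := by
      intro h0
      rw [hb i, h0, zero_smul] at hi
      exact hi rfl
    have hd : (symMat (a i)).det ≠ 0 := by
      intro h0
      have := det_adjugate_symMat (a i)
      rw [h0, hb i, det_smul] at this
      simp [hci, hdet] at this
    have h1 := adjugate_adjugate_symMat (a i)
    rw [hb i, adjugate_smul] at h1
    refine ⟨(symMat (a i)).det⁻¹ * c i ^ (Fintype.card (Fin 3) - 1), ?_, ?_⟩
    · exact mul_ne_zero (inv_ne_zero hd) (pow_ne_zero _ hci)
    · rw [mul_smul, h1, smul_smul, inv_mul_cancel₀ hd, one_smul]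
  refine h.not_proportional (a k) fun i hi => ?_
  obtain ⟨e, he, hAe⟩ := hA i hi
  obtain ⟨e', he', hAe'⟩ := hA k hk
  refine ⟨e * e'⁻¹, symMat_injective ?_⟩
  rw [map_smul, hAe, hAe', smul_smul, mul_assoc, inv_mul_cancel₀ he', mul_one]

theorem not_adjugates_proportional (h : IsRigidFamily a) (b : Matrix (Fin 3) (Fin 3) ℂ)
    (hb : ∀ i, ∃ c : ℂ, adjugate (symMat (a i)) = c • b) : False := by
  classical
  choose c hc using hb
  by_cases hall : ∀ i, adjugate (symMat (a i)) = 0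
  · exact h.not_proportional 0 fun i hi => absurd (hall i) hi
  push Not at hall
  obtain ⟨k, hk⟩ := hall
  have hdetb := h.not_proportional_det_ne_zero hc hk
  have hdet : ∀ i, (symMat (a i)).det = 0 := fun i => by
    have := det_adjugate_symMat (a i)
    rw [hc i, det_smul, hdetb, mul_zero] at this
    exact (pow_eq_zero_iff two_ne_zero).1 this.symm
  obtain ⟨u, hu, hku, -⟩ := exists_adjugate_eq_vecMulVec (hdet k) hk
  have hck : c k ≠ 0 := by
    intro h0
    rw [hc k, h0, zero_smul] at hk
    exact hk rfl
  have hAu : ∀ i, adjugate (symMat (a i)) ≠ 0 → symMat (a i) *ᵥ u = 0 := fun i hi => by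
    have hci : c i ≠ 0 := by
      intro h0
      rw [hc i, h0, zero_smul] at hi
      exact hi rfl
    have h1 := mul_adjugate (symMat (a i))
    rw [hdet i, zero_smul, hc i, mul_smul_comm] at h1
    have h2 : symMat (a i) * b = 0 := (smul_eq_zero.1 h1).resolve_left hci
    apply vecMulVec_eq_zero_left hu
    rw [← mul_vecMulVec, ← hku, hc k, mul_smul_comm, h2, smul_zero]
  let J : Finset (Fin 9) := {i | adjugate (symMat (a i)) ≠ 0}
  let I : Finset (Fin 9) := {i | symMat (a i) *ᵥ u ≠ 0}
  have hIJ : I ⊆ Jᶜ := fun i hi => by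
    simp only [I, J, Finset.mem_filter, Finset.mem_univ, true_and, Finset.mem_compl, not_not]
      at hi ⊢
    by_contra hn
    exact hi (hAu i hn)
  have hspan := h.span_eq_top hu I (fun i hi => by simpa [I] using hi)
  have hI6 : 6 ≤ I.card := by
    have h1 := finrank_range_le_card (R := ℂ) (fun i : I => a i)
    rw [Set.finrank, hspan, finrank_top] at h1
    simpa using h1
  have hJ := finrank_span_restrict_add_le J (fun i hi => by simpa [J] using hi) h.relation
  have hpos : 1 ≤ finrank ℂ
      (Submodule.span ℂ (Set.range fun i => adjugate (symMat (a i)))) := by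
    rw [Submodule.one_le_finrank_iff]
    intro h0
    have : adjugate (symMat (a k)) ∈
        Submodule.span ℂ (Set.range fun i => adjugate (symMat (a i))) :=
      Submodule.subset_span ⟨k, rfl⟩
    rw [h0] at this
    exact hk (by simpa using this)
  have hcard : I.card + J.card ≤ 9 := by
    have h1 := Finset.card_le_card hIJ
    rw [Finset.card_compl, Fintype.card_fin] at h1
    have h2 := J.card_le_univ
    rw [Fintype.card_fin] at h2
    omega
  by_cases hJ3 : J.card ≤ 2
  · have h1 : finrank ℂ (Submodule.span ℂ (Set.range fun i : J => a i)) ≤ 1 := by omega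
    rw [finrank_le_one_iff] at h1
    obtain ⟨⟨v, hv⟩, hv'⟩ := h1
    refine h.not_proportional v fun i hi => ?_
    obtain ⟨μ, hμ⟩ := hv' ⟨a i, Submodule.subset_span ⟨⟨i, by simpa [J] using hi⟩, rfl⟩⟩
    exact ⟨μ, by simpa using (congrArg Subtype.val hμ).symm⟩
  have hIeq : I = Jᶜ := Finset.eq_of_subset_of_card_le hIJ (by
    rw [Finset.card_compl, Fintype.card_fin]
    omega)
  have hli : LinearIndependent ℂ (fun i : I => a i) :=
    linearIndependent_of_top_le_span_of_card_eq_finrank hspan.ge (by simp; omega)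
  obtain ⟨w, hw, hwS⟩ : ∃ w, u ⬝ᵥ w = 0 ∧
      nu w ∉ Submodule.span ℂ (Set.range fun i : J => a i) := by
    by_contra! hcon
    have := three_le_finrank_of_nu_mem hu _ hcon
    omega
  obtain ⟨Q, hQw, hQ⟩ := Submodule.exists_le_ker_of_notMem hwS
  have hw0 : w ≠ 0 := by
    rintro rfl
    apply hQw
    have : nu 0 = 0 := by ext i; fin_cases i <;> simp [nu]
    rw [this, map_zero]
  obtain ⟨l, hl⟩ := exists_dotProduct_ne_zero hw0
  have hex : ∀ i : I, ∃ y : ℂ, symMat (a i) *ᵥ (Q (a i) • l + y • u) = 0 := by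
    rintro ⟨i, hi⟩
    have hiJ : adjugate (symMat (a i)) = 0 := by
      rw [hIeq] at hi
      simpa [J] using hi
    obtain ⟨v, hv⟩ := exists_nu_eq_of_adjugate_eq_zero hiJ
    have hiu : symMat (a i) *ᵥ u ≠ 0 := by simpa [I] using hi
    simp only [← hv, symMat_nu, vecMulVec_mulVec, mulVec_add, mulVec_smul] at hiu ⊢
    have hvu : v ⬝ᵥ u ≠ 0 := by
      intro h0
      simp [h0] at hiu
    refine ⟨-Q (nu v) * (v ⬝ᵥ l) / (v ⬝ᵥ u), ?_⟩
    ext p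
    simp
    field_simp
    ring
  choose y hy using hex
  obtain ⟨Q', hQ'⟩ := exists_dual_apply_eq (fun i : I => a i) y (fun κ hκ => by
    rw [Fintype.linearIndependent_iff] at hli
    simp [hli κ hκ])
  have hθ := h.radical (θ := Q.smulRight l + Q'.smulRight u) (fun i => by
    by_cases hi : i ∈ I
    · have hQi := hQ' ⟨i, hi⟩
      simp only at hQi
      simpa only [LinearMap.add_apply, LinearMap.smulRight_apply, hQi] using hy ⟨i, hi⟩
    · have hiJ : i ∈ J := by
        rw [hIeq] at hi
        simpa using hi
      have hQi : Q (a i) = 0 := hQ (Submodule.subset_span ⟨⟨i, hiJ⟩, rfl⟩)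
      have hiu : symMat (a i) *ᵥ u = 0 := by simpa [I] using hi
      simp [hQi, mulVec_smul, hiu]) w
  simp [dotProduct_add, dotProduct_smul, dotProduct_comm w u, hw] at hθ
  rcases hθ with hθ | hθ
  · exact hQw hθ
  · exact hl hθ

end IsRigidFamily

section LinearForms

theorem exists_dotProduct_eq_zero_ne_zero {n : ℕ} {u l : Fin n → ℂ} (hl : ∀ c : ℂ, l ≠ c • u) :
    ∃ v, u ⬝ᵥ v = 0 ∧ l ⬝ᵥ v ≠ 0 := by
  by_contra! h
  by_cases hu : u = 0
  · refine hl 0 ?_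
    rw [zero_smul]
    exact dotProduct_eq_zero l fun v => h v (by simp [hu])
  · obtain ⟨w, hw⟩ := exists_dotProduct_ne_zero hu
    refine hl ((l ⬝ᵥ w) / (u ⬝ᵥ w)) (dotProduct_eq _ _ fun v => ?_)
    have := h (v - ((u ⬝ᵥ v) / (u ⬝ᵥ w)) • w) (by
      simp only [dotProduct_sub, dotProduct_smul, smul_eq_mul]
      field_simp
      ring)
    simp only [dotProduct_sub, dotProduct_smul, smul_eq_mul] at this
    rw [smul_dotProduct, smul_eq_mul]
    linear_combination this

theorem exists_dotProduct_eq_zero_ne_zero_and {n : ℕ} {u l y : Fin n → ℂ}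
    (hl : ∀ c : ℂ, l ≠ c • u) (hy : ∀ c : ℂ, y ≠ c • u) :
    ∃ v, u ⬝ᵥ v = 0 ∧ l ⬝ᵥ v ≠ 0 ∧ y ⬝ᵥ v ≠ 0 := by
  obtain ⟨v, huv, hv⟩ := exists_dotProduct_eq_zero_ne_zero hl
  obtain ⟨w, huw, hw⟩ := exists_dotProduct_eq_zero_ne_zero hy
  by_cases h1 : y ⬝ᵥ v = 0
  · by_cases h2 : l ⬝ᵥ w = 0
    · exact ⟨v + w, by simp [dotProduct_add, huv, huw], by simp [dotProduct_add, h2, hv],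
        by simp [dotProduct_add, h1, hw]⟩
    · exact ⟨w, huw, h2, hw⟩
  · exact ⟨v, huv, hv, h1⟩

theorem eq_smul_of_dotProduct_mul {n : ℕ} {p s t : Fin n → ℂ} (hp : p ≠ 0) {c : ℂ}
    (h : ∀ v, (p ⬝ᵥ v) * (s ⬝ᵥ v) = (p ⬝ᵥ v) * (c * (t ⬝ᵥ v))) : s = c • t := by
  by_contra hne
  obtain ⟨v, hv, hv'⟩ := exists_dotProduct_ne_zero_and hp (sub_ne_zero.2 hne)
  rw [sub_dotProduct, smul_dotProduct, smul_eq_mul, sub_ne_zero] at hv'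
  exact hv' (mul_left_cancel₀ hv (h v))

/-- A two-by-two matrix of linear forms with vanishing determinant has proportional rows or
proportional columns. -/
theorem proportional_of_det_eq_zero {n : ℕ} {p₁ p₂ q₁ q₂ : Fin n → ℂ}
    (h : ∀ v, (p₁ ⬝ᵥ v) * (q₂ ⬝ᵥ v) = (p₂ ⬝ᵥ v) * (q₁ ⬝ᵥ v)) :
    (∃ s t : ℂ, (s ≠ 0 ∨ t ≠ 0) ∧ s • p₁ + t • p₂ = 0 ∧ s • q₁ + t • q₂ = 0) ∨
    (∃ s t : ℂ, (s ≠ 0 ∨ t ≠ 0) ∧ s • p₁ + t • q₁ = 0 ∧ s • p₂ + t • q₂ = 0) := by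
  by_cases hp : p₁ = 0
  · subst hp
    by_cases hp2 : p₂ = 0
    · exact Or.inr ⟨1, 0, by simp, by simp, by simp [hp2]⟩
    · have hq : q₁ = (0 : ℂ) • (0 : Fin n → ℂ) := eq_smul_of_dotProduct_mul hp2 fun v => by
        rw [← h v]; simp
      exact Or.inl ⟨1, 0, by simp, by simp, by simp [hq]⟩
  by_cases h2 : ∃ c : ℂ, p₂ = c • p₁
  · obtain ⟨c, rfl⟩ := h2
    have hq : q₂ = c • q₁ := eq_smul_of_dotProduct_mul hp fun v => by
      rw [h v, smul_dotProduct, smul_eq_mul]; ring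
    exact Or.inl ⟨-c, 1, by simp, by simp, by simp [hq]⟩
  by_cases h1 : ∃ c : ℂ, q₁ = c • p₁
  · obtain ⟨c, rfl⟩ := h1
    have hq : q₂ = c • p₂ := eq_smul_of_dotProduct_mul hp fun v => by
      rw [h v, smul_dotProduct, smul_eq_mul]; ring
    exact Or.inr ⟨-c, 1, by simp, by simp, by simp [hq]⟩
  push Not at h1 h2
  obtain ⟨v, hv, hv1, hv2⟩ := exists_dotProduct_eq_zero_ne_zero_and h2 h1
  have := h v
  rw [hv, zero_mul] at this
  exact absurd this.symm (mul_ne_zero hv1 hv2)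

theorem exists_orthogonal_not_smul (z u : Fin 3 → ℂ) :
    ∃ y, z ⬝ᵥ y = 0 ∧ ∀ c : ℂ, y ≠ c • u := by
  have key : ∀ z : Fin 3 → ℂ, z ≠ 0 → ∃ y, z ⬝ᵥ y = 0 ∧ ∀ c : ℂ, y ≠ c • u := fun z hz => by
    obtain ⟨w₁, w₂, f₁, f₂, h1, h2, h11, h12, h21, h22, -⟩ := exists_basis_orthogonal hz
    by_contra! hcon
    obtain ⟨c, rfl⟩ := hcon w₁ h1
    obtain ⟨d, rfl⟩ := hcon w₂ h2
    simp only [dotProduct_smul, smul_eq_mul] at h11 h12 h21 h22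
    grind
  by_cases hz : z = 0
  · obtain ⟨y, -, hy⟩ := key ![1, 0, 0] (fun h => by simpa using congrFun h 0)
    exact ⟨y, by simp [hz], hy⟩
  · exact key z hz

theorem exists_dual_pair {n u l : Fin 3 → ℂ} (hn : n ≠ 0) (hnu : n ⬝ᵥ u = 0) (hnl : n ⬝ᵥ l = 0)
    (hu : u ≠ 0) (hl : ∀ c : ℂ, l ≠ c • u) :
    ∃ f g : Fin 3 → ℂ, g ⬝ᵥ u = 1 ∧ g ⬝ᵥ l = 0 ∧ f ⬝ᵥ u = 0 ∧ f ⬝ᵥ l = 1 ∧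
      ∀ w, n ⬝ᵥ w = 0 → w = (g ⬝ᵥ w) • u + (f ⬝ᵥ w) • l := by
  obtain ⟨w₁, w₂, f₁, f₂, h1, h2, h11, h12, h21, h22, hw⟩ := exists_basis_orthogonal hn
  have hD : (f₁ ⬝ᵥ u) * (f₂ ⬝ᵥ l) - (f₂ ⬝ᵥ u) * (f₁ ⬝ᵥ l) ≠ 0 := by
    intro h0
    have hu' := hw u hnu
    have hl' := hw l hnl
    by_cases hs : f₁ ⬝ᵥ u = 0
    · have ht : f₂ ⬝ᵥ u ≠ 0 := by
        intro ht
        apply hu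
        rw [hu', hs, ht]
        simp
      refine hl ((f₂ ⬝ᵥ l) / (f₂ ⬝ᵥ u)) ?_
      have h3 : f₁ ⬝ᵥ l = 0 := by
        rw [hs, zero_mul, zero_sub, neg_eq_zero] at h0
        exact (mul_eq_zero.1 h0).resolve_left ht
      ext i
      have eui := congrFun hu' i
      have eli := congrFun hl' i
      simp only [hs, h3, Pi.add_apply, Pi.smul_apply, smul_eq_mul] at eui eli ⊢
      rw [eli, eui]
      field_simp
      ring
    · refine hl ((f₁ ⬝ᵥ l) / (f₁ ⬝ᵥ u)) ?_
      have h3 : f₂ ⬝ᵥ l = (f₂ ⬝ᵥ u) * (f₁ ⬝ᵥ l) / (f₁ ⬝ᵥ u) := by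
        field_simp
        linear_combination h0
      ext i
      have eui := congrFun hu' i
      have eli := congrFun hl' i
      simp only [h3, Pi.add_apply, Pi.smul_apply, smul_eq_mul] at eui eli ⊢
      rw [eli, eui]
      field_simp
  set D := (f₁ ⬝ᵥ u) * (f₂ ⬝ᵥ l) - (f₂ ⬝ᵥ u) * (f₁ ⬝ᵥ l) with hDdef
  refine ⟨D⁻¹ • ((f₁ ⬝ᵥ u) • f₂ - (f₂ ⬝ᵥ u) • f₁), D⁻¹ • ((f₂ ⬝ᵥ l) • f₁ - (f₁ ⬝ᵥ l) • f₂),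
    ?_, ?_, ?_, ?_, fun w hnw => ?_⟩
  on_goal 5 =>
    have e := hw w hnw
    have eu := hw u hnu
    have el := hw l hnl
    simp only [smul_dotProduct, sub_dotProduct, smul_eq_mul]
    ext i
    have ei := congrFun e i
    have eui := congrFun eu i
    have eli := congrFun el i
    simp only [Pi.add_apply, Pi.smul_apply, smul_eq_mul] at ei eui eli ⊢
    rw [ei, eui, eli]
    field_simp
    rw [hDdef]
    ring
  all_goals simp only [smul_dotProduct, sub_dotProduct, smul_eq_mul]
  · field_simp
    rw [hDdef]
    ring
  · ring
  · ring
  · field_simp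
    rw [hDdef]

end LinearForms

section Coordinates

variable {K N ι : Type*} [Field K] [AddCommGroup N] [Module K N] [FiniteDimensional K N]

theorem exists_coordinates {n : ℕ} (b : ι → N)
    (hn : finrank K (Submodule.span K (Set.range b)) = n) :
    ∃ (β : Fin n → N) (φ : Fin n → Dual K N) (x : ι → Fin n → K),
      (∀ i, b i = ∑ j, x i j • β j) ∧ (∀ i j, φ j (b i) = x i j) ∧
      ∀ z : Fin n → K, (∀ i, ∑ j, z j * x i j = 0) → z = 0 := by
  let B := finBasisOfFinrankEq K (Submodule.span K (Set.range b)) hn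
  have hmem : ∀ i, b i ∈ Submodule.span K (Set.range b) := fun i => Submodule.subset_span ⟨i, rfl⟩
  choose φ hφ using fun j => LinearMap.exists_extend (B.coord j)
  have hφ' : ∀ j (w : Submodule.span K (Set.range b)), φ j w = B.repr w j := fun j w => by
    rw [← Basis.coord_apply, ← hφ j]
    rfl
  refine ⟨fun j => B j, φ, fun i j => B.repr ⟨b i, hmem i⟩ j, fun i => ?_,
    fun i j => hφ' j ⟨b i, hmem i⟩, fun z hz => ?_⟩
  · have := congrArg Subtype.val (B.sum_repr ⟨b i, hmem i⟩)
    rw [AddSubmonoidClass.coe_finsetSum] at this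
    exact this.symm
  · let F : Dual K N := ∑ j, z j • φ j
    have hF : ∀ i, F (b i) = 0 := fun i => by
      rw [← hz i]
      simp only [F, LinearMap.sum_apply, LinearMap.smul_apply, smul_eq_mul]
      exact Finset.sum_congr rfl fun j _ => by rw [hφ' j ⟨b i, hmem i⟩]
    have hle : Submodule.span K (Set.range b) ≤ F.ker := by
      rw [Submodule.span_le]
      rintro _ ⟨i, rfl⟩
      exact hF i
    ext k
    have h1 : F (B k) = 0 := hle (B k).2
    simp only [F, LinearMap.sum_apply, LinearMap.smul_apply, smul_eq_mul, hφ', B.repr_self] at h1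
    simpa [Finsupp.single_apply] using h1

/-- A family whose span is two-dimensional is spanned by any two independent members. -/
theorem exists_eq_smul_add_smul {b : ι → N} {k l : ι}
    (hn : finrank K (Submodule.span K (Set.range b)) ≤ 2) (hk : b k ≠ 0)
    (hl : ∀ c : K, b l ≠ c • b k) (i : ι) : ∃ x y : K, b i = x • b k + y • b l := by
  have hli : LinearIndependent K ![b k, b l] := by
    rw [LinearIndependent.pair_iff' hk]
    exact fun c => (hl c).symm
  have heq : Submodule.span K (Set.range ![b k, b l]) = Submodule.span K (Set.range b) :=
    Submodule.eq_of_le_of_finrank_le (by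
      rw [Submodule.span_le]
      rintro _ ⟨j, rfl⟩
      fin_cases j
      · exact Submodule.subset_span ⟨k, rfl⟩
      · exact Submodule.subset_span ⟨l, rfl⟩) (by
      rw [finrank_span_eq_card hli]
      simpa using hn)
  have hi : b i ∈ Submodule.span K (Set.range ![b k, b l]) := by
    rw [heq]
    exact Submodule.subset_span ⟨i, rfl⟩
  simp only [Matrix.range_cons, Matrix.range_empty, Set.union_empty, Set.singleton_union,
    Submodule.mem_span_pair] at hi
  obtain ⟨x, y, hxy⟩ := hi
  exact ⟨x, y, hxy.symm⟩

theorem exists_eq_smul_add_smul_add_smul {b : ι → N} {k l : ι}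
    (hn : finrank K (Submodule.span K (Set.range b)) = 3) (hk : b k ≠ 0)
    (hl : ∀ c : K, b l ≠ c • b k) :
    ∃ m, (∀ x y : K, b m ≠ x • b k + y • b l) ∧
      ∀ i, ∃ x y z : K, b i = x • b k + y • b l + z • b m := by
  have hli : LinearIndependent K ![b k, b l] := by
    rw [LinearIndependent.pair_iff' hk]
    exact fun c => (hl c).symm
  have hspan : ∀ w, w ∈ Submodule.span K (Set.range ![b k, b l]) ↔
      ∃ x y : K, x • b k + y • b l = w := fun w => by
    simp only [Matrix.range_cons, Matrix.range_empty, Set.union_empty, Set.singleton_union,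
      Submodule.mem_span_pair]
  obtain ⟨m, hm⟩ : ∃ m, b m ∉ Submodule.span K (Set.range ![b k, b l]) := by
    by_contra! hcon
    have hle : Submodule.span K (Set.range b) ≤ Submodule.span K (Set.range ![b k, b l]) := by
      rw [Submodule.span_le]
      rintro _ ⟨i, rfl⟩
      exact hcon i
    have := Submodule.finrank_mono hle
    rw [finrank_span_eq_card hli, hn] at this
    simp at this
  refine ⟨m, fun x y h => hm ((hspan _).2 ⟨x, y, h.symm⟩), fun i => ?_⟩
  have hli3 : LinearIndependent K (Fin.cons (b m) ![b k, b l] : Fin 3 → N) :=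
    linearIndependent_finCons.2 ⟨hli, hm⟩
  have heq : Submodule.span K (Set.range (Fin.cons (b m) ![b k, b l] : Fin 3 → N)) =
      Submodule.span K (Set.range b) :=
    Submodule.eq_of_le_of_finrank_le (by
      rw [Submodule.span_le]
      rintro _ ⟨j, rfl⟩
      fin_cases j
      · exact Submodule.subset_span ⟨m, rfl⟩
      · exact Submodule.subset_span ⟨k, rfl⟩
      · exact Submodule.subset_span ⟨l, rfl⟩) (by
      rw [finrank_span_eq_card hli3, hn]
      simp)
  have hi : b i ∈ Submodule.span K (Set.range (Fin.cons (b m) ![b k, b l] : Fin 3 → N)) := by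
    rw [heq]
    exact Submodule.subset_span ⟨i, rfl⟩
  rw [Fin.range_cons, Submodule.mem_span_insert] at hi
  obtain ⟨z, w, hw, hi⟩ := hi
  obtain ⟨x, y, rfl⟩ := (hspan w).1 hw
  exact ⟨x, y, z, by rw [hi, add_comm]⟩

end Coordinates

namespace IsRigidFamily

variable {a : Fin 9 → Fin 6 → ℂ}

theorem two_le_finrank_adjugate (h : IsRigidFamily a) :
    2 ≤ finrank ℂ (Submodule.span ℂ (Set.range fun i => adjugate (symMat (a i)))) := by
  by_contra hlt
  have h1 : finrank ℂ (Submodule.span ℂ (Set.range fun i => adjugate (symMat (a i)))) ≤ 1 := by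
    omega
  rw [finrank_le_one_iff] at h1
  obtain ⟨⟨b, hb⟩, hb'⟩ := h1
  refine h.not_adjugates_proportional b fun i => ?_
  obtain ⟨c, hc⟩ := hb' ⟨adjugate (symMat (a i)), Submodule.subset_span ⟨i, rfl⟩⟩
  exact ⟨c, (congrArg Subtype.val hc).symm⟩

theorem eq_of_adjugate_eq_zero (h : IsRigidFamily a) {i j : Fin 9}
    (hi : adjugate (symMat (a i)) = 0) (hj : adjugate (symMat (a j)) = 0) : i = j := by
  by_contra hij
  obtain ⟨v, hv⟩ := exists_nu_eq_of_adjugate_eq_zero hi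
  obtain ⟨w, hw⟩ := exists_nu_eq_of_adjugate_eq_zero hj
  obtain ⟨u, hu, hM⟩ := exists_mulVec_eq_zero_iff.2
    (det_eq_zero_of_row_eq_zero (A := Matrix.of ![v, w, 0]) 2 (fun _ => rfl))
  have hv0 : v ⬝ᵥ u = 0 := congrFun hM 0
  have hw0 : w ⬝ᵥ u = 0 := congrFun hM 1
  have hI : ∀ k ∉ ({i, j}ᶜ : Finset (Fin 9)),
      adjugate (symMat (a k)) = 0 ∧ symMat (a k) *ᵥ u = 0 := fun k hk => by
    simp only [Finset.mem_compl, Finset.mem_insert, Finset.mem_singleton, not_not] at hk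
    rcases hk with rfl | rfl
    · exact ⟨hi, by rw [← hv, symMat_nu, vecMulVec_mulVec, hv0]; simp⟩
    · exact ⟨hj, by rw [← hw, symMat_nu, vecMulVec_mulVec, hw0]; simp⟩
  have h6 := h.finrank_span hu _ fun k hk => (hI k hk).2
  have hle := finrank_span_restrict_add_le _ (fun k hk => (hI k hk).1) h.relation
  rw [h6, Finset.card_compl, Finset.card_pair hij] at hle
  have := h.two_le_finrank_adjugate
  simp at hle
  omega

theorem exists_common_kernel (h : IsRigidFamily a) :
    ∃ u, u ≠ 0 ∧ ∀ i, adjugate (symMat (a i)) = 0 → symMat (a i) *ᵥ u = 0 := by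
  by_cases hex : ∃ k, adjugate (symMat (a k)) = 0
  · obtain ⟨k, hk⟩ := hex
    obtain ⟨v, hv⟩ := exists_nu_eq_of_adjugate_eq_zero hk
    obtain ⟨u, huv, hu⟩ := exists_orthogonal_not_smul v 0
    refine ⟨u, by simpa using hu 0, fun i hi => ?_⟩
    rw [h.eq_of_adjugate_eq_zero hi hk, ← hv, symMat_nu, vecMulVec_mulVec, huv]
    simp
  · push Not at hex
    exact ⟨![1, 0, 0], fun h0 => by simpa using congrFun h0 0, fun i hi => absurd hi (hex i)⟩

theorem dual_eq_zero_of_adjugate_ne_zero (h : IsRigidFamily a) {Q : Dual ℂ (Fin 6 → ℂ)}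
    (hQ : ∀ i, adjugate (symMat (a i)) ≠ 0 → Q (a i) = 0) : Q = 0 := by
  obtain ⟨u, hu, hu'⟩ := h.exists_common_kernel
  exact h.dual_eq_zero hu fun i hi => hQ i fun h0 => hi (hu' i h0)

theorem span_range_eq_top (h : IsRigidFamily a) : Submodule.span ℂ (Set.range a) = ⊤ := by
  by_contra hne
  obtain ⟨Q, hQ0, hQ⟩ := Submodule.exists_le_ker_of_lt_top _ (lt_top_iff_ne_top.2 hne)
  exact hQ0 (h.dual_eq_zero_of_adjugate_ne_zero fun i _ => hQ (Submodule.subset_span ⟨i, rfl⟩))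

theorem finrank_adjugate_le (h : IsRigidFamily a) :
    finrank ℂ (Submodule.span ℂ (Set.range fun i => adjugate (symMat (a i)))) ≤ 3 := by
  have hle := finrank_span_add_finrank_span_le h.relation
  rw [h.span_range_eq_top, finrank_top] at hle
  simp at hle
  omega

theorem adjugate_ne_zero (h : IsRigidFamily a)
    (h3 : finrank ℂ (Submodule.span ℂ (Set.range fun i => adjugate (symMat (a i)))) = 3)
    (k : Fin 9) : adjugate (symMat (a k)) ≠ 0 := by
  intro hk
  obtain ⟨u, hu, hu'⟩ := h.exists_common_kernel
  have hI : ∀ i ∉ ({k}ᶜ : Finset (Fin 9)), i = k := fun i hi => by simpa using hi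
  have h6 := h.finrank_span hu {k}ᶜ fun i hi => by
    rw [hI i hi]
    exact hu' k hk
  have hle := finrank_span_restrict_add_le {k}ᶜ (fun i hi => by
    rw [hI i hi]
    exact hk) h.relation
  rw [h6, h3, Finset.card_compl] at hle
  simp at hle

end IsRigidFamily

/-- The polarised adjugates of a triple of matrices. -/
noncomputable def polarAdjugate (β : Fin 3 → Matrix (Fin 3) (Fin 3) ℂ) :
    Fin 6 → Matrix (Fin 3) (Fin 3) ℂ :=
  ![adjugate (β 0), (2⁻¹ : ℂ) • (adjugate (β 0 + β 1) - adjugate (β 0) - adjugate (β 1)),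
    (2⁻¹ : ℂ) • (adjugate (β 0 + β 2) - adjugate (β 0) - adjugate (β 2)), adjugate (β 1),
    (2⁻¹ : ℂ) • (adjugate (β 1 + β 2) - adjugate (β 1) - adjugate (β 2)), adjugate (β 2)]

theorem adjugate_sum_smul (β : Fin 3 → Matrix (Fin 3) (Fin 3) ℂ) (x : Fin 3 → ℂ) :
    adjugate (∑ j, x j • β j) = ∑ m, nu x m • polarAdjugate β m := by
  simp only [Fin.sum_univ_three, Fin.sum_univ_six, polarAdjugate, nu]
  ext i j
  fin_cases i <;> fin_cases j <;> simp [adjugate_fin_three] <;> ring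

namespace IsRigidFamily

variable {a : Fin 9 → Fin 6 → ℂ}

theorem symMat_eq_polarAdjugate {β : Fin 3 → Matrix (Fin 3) (Fin 3) ℂ} {x : Fin 9 → Fin 3 → ℂ}
    (hβ : ∀ i, adjugate (symMat (a i)) = ∑ j, x i j • β j) {i : Fin 9}
    (hi : (symMat (a i)).det ≠ 0) :
    symMat (a i) = ∑ m, ((symMat (a i)).det⁻¹ * nu (x i) m) • polarAdjugate β m := by
  have h1 := adjugate_adjugate_symMat (a i)
  rw [hβ i, adjugate_sum_smul] at h1
  simp only [mul_smul, ← Finset.smul_sum, h1]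
  rw [smul_smul, inv_mul_cancel₀ hi, one_smul]

theorem linearIndependent_polarAdjugate (h : IsRigidFamily a)
    (hdet : ∀ i, adjugate (symMat (a i)) ≠ 0 → (symMat (a i)).det ≠ 0)
    {β : Fin 3 → Matrix (Fin 3) (Fin 3) ℂ} {x : Fin 9 → Fin 3 → ℂ}
    (hβ : ∀ i, adjugate (symMat (a i)) = ∑ j, x i j • β j) :
    LinearIndependent ℂ (polarAdjugate β) := by
  have htop : (Submodule.span ℂ (Set.range (polarAdjugate β))).comap symMat = ⊤ := by
    by_contra hne
    obtain ⟨Q, hQ0, hQ⟩ := Submodule.exists_le_ker_of_lt_top _ (lt_top_iff_ne_top.2 hne)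
    refine hQ0 (h.dual_eq_zero_of_adjugate_ne_zero fun i hi => hQ ?_)
    rw [Submodule.mem_comap, symMat_eq_polarAdjugate hβ (hdet i hi)]
    exact Submodule.sum_mem _ fun m _ => Submodule.smul_mem _ _ (Submodule.subset_span ⟨m, rfl⟩)
  have hle : symMat.range ≤ Submodule.span ℂ (Set.range (polarAdjugate β)) := by
    rw [LinearMap.range_eq_map, ← htop]
    exact Submodule.map_comap_le _ _
  have h6 := Submodule.finrank_mono hle
  rw [LinearMap.finrank_range_of_inj symMat_injective] at h6
  rw [linearIndependent_iff_card_le_finrank_span, Set.finrank]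
  simpa using h6

theorem not_det_ne_zero_of_finrank_two (h : IsRigidFamily a)
    (hdet : ∀ i, adjugate (symMat (a i)) ≠ 0 → (symMat (a i)).det ≠ 0)
    (h2 : finrank ℂ (Submodule.span ℂ (Set.range fun i => adjugate (symMat (a i)))) = 2) :
    False := by
  obtain ⟨β, -, x, hβ, -, -⟩ := exists_coordinates _ h2
  have hli := h.linearIndependent_polarAdjugate hdet (β := ![β 0, β 1, 0])
    (x := fun i => ![x i 0, x i 1, 0]) (fun i => by
      rw [hβ i]
      simp [Fin.sum_univ_three])
  exact hli.ne_zero 5 (by simp [polarAdjugate, adjugate_zero])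

theorem not_det_ne_zero_of_finrank_three (h : IsRigidFamily a)
    (hdet : ∀ i, (symMat (a i)).det ≠ 0)
    (h3 : finrank ℂ (Submodule.span ℂ (Set.range fun i => adjugate (symMat (a i)))) = 3) :
    False := by
  obtain ⟨β, φ, x, hβ, hφ, hx⟩ := exists_coordinates _ h3
  have hli := h.linearIndependent_polarAdjugate (fun i _ => hdet i) hβ
  have hrel : ∀ l, ∑ i, x i l • a i = 0 := fun l => by
    simpa only [hφ] using h.relation (φ l)
  have hnu : ∀ l m, ∑ i, x i l * ((symMat (a i)).det⁻¹ * nu (x i) m) = 0 := fun l => by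
    have h1 := congrArg symMat (hrel l)
    simp only [map_sum, map_smul, map_zero] at h1
    rw [Fintype.linearIndependent_iff] at hli
    apply hli
    rw [← h1]
    simp only [Finset.sum_smul]
    rw [Finset.sum_comm]
    refine Finset.sum_congr rfl fun i _ => ?_
    conv_rhs => rw [symMat_eq_polarAdjugate hβ (hdet i)]
    rw [Finset.smul_sum]
    simp only [mul_smul]
  have hcub : ∀ l j k, ∑ i, x i l * ((symMat (a i)).det⁻¹ * (x i j * x i k)) = 0 := by
    have key : ∀ (l j k : Fin 3) (m : Fin 6) (c : ℂ), (∀ i, x i j * x i k = c * nu (x i) m) →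
        ∑ i, x i l * ((symMat (a i)).det⁻¹ * (x i j * x i k)) = 0 := fun l j k m c hc => by
      have : ∑ i, x i l * ((symMat (a i)).det⁻¹ * (x i j * x i k)) =
          c * ∑ i, x i l * ((symMat (a i)).det⁻¹ * nu (x i) m) := by
        rw [Finset.mul_sum]
        refine Finset.sum_congr rfl fun i _ => ?_
        rw [hc i]
        ring
      rw [this, hnu, mul_zero]
    intro l j k
    fin_cases j <;> fin_cases k
    · exact key l 0 0 0 1 fun i => by simp [nu]; ring
    · exact key l 0 1 1 2⁻¹ fun i => by simp [nu]; ring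
    · exact key l 0 2 2 2⁻¹ fun i => by simp [nu]; ring
    · exact key l 1 0 1 2⁻¹ fun i => by simp [nu]; ring
    · exact key l 1 1 3 1 fun i => by simp [nu]; ring
    · exact key l 1 2 4 2⁻¹ fun i => by simp [nu]; ring
    · exact key l 2 0 2 2⁻¹ fun i => by simp [nu]; ring
    · exact key l 2 1 4 2⁻¹ fun i => by simp [nu]; ring
    · exact key l 2 2 5 1 fun i => by simp [nu]; ring
  have hsolve : ∀ Z : Matrix (Fin 3) (Fin 3) ℂ, ∃ θ : (Fin 6 → ℂ) →ₗ[ℂ] (Fin 3 → ℂ),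
      ∀ i, symMat (a i) *ᵥ θ (a i) = Z *ᵥ x i := fun Z => by
    have hq : ∀ p, ∃ q : Dual ℂ (Fin 6 → ℂ), ∀ i,
        q (a i) = (symMat (a i)).det⁻¹ * (adjugate (symMat (a i)) *ᵥ (Z *ᵥ x i)) p := fun p => by
      refine exists_dual_apply_eq a _ fun κ hκ => ?_
      obtain ⟨ψ, hψ⟩ := exists_dual_of_relation h.relation (by
        rw [h.span_range_eq_top, h3, finrank_top]
        simp) κ hκ
      have hterm : ∀ i, κ i * ((symMat (a i)).det⁻¹ *
          (adjugate (symMat (a i)) *ᵥ (Z *ᵥ x i)) p) =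
          ∑ l, ∑ j, ∑ k, (ψ (β l) * (β j * Z) p k) *
            (x i l * ((symMat (a i)).det⁻¹ * (x i j * x i k))) := fun i => by
        rw [hψ i, hβ i, mulVec_mulVec, Finset.sum_mul]
        simp only [map_sum, map_smul, smul_eq_mul, mulVec, dotProduct, Matrix.sum_apply,
          Matrix.smul_apply, smul_mul, Finset.sum_mul, Finset.mul_sum]
        simp only [Fin.sum_univ_three]
        ring
      simp only [hterm]
      rw [Finset.sum_comm]
      refine Finset.sum_eq_zero fun l _ => ?_
      rw [Finset.sum_comm]
      refine Finset.sum_eq_zero fun j _ => ?_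
      rw [Finset.sum_comm]
      refine Finset.sum_eq_zero fun k _ => ?_
      rw [← Finset.mul_sum, hcub, mul_zero]
    choose q hq using hq
    refine ⟨LinearMap.pi q, fun i => ?_⟩
    have : LinearMap.pi q (a i) =
        (symMat (a i)).det⁻¹ • (adjugate (symMat (a i)) *ᵥ (Z *ᵥ x i)) := by
      ext p
      simpa using hq p i
    rw [this, mulVec_smul, mulVec_mulVec, mul_adjugate, smul_mulVec, one_mulVec, smul_smul,
      inv_mul_cancel₀ (hdet i), one_smul]
  let Ψ : ((Fin 6 → ℂ) →ₗ[ℂ] (Fin 3 → ℂ)) →ₗ[ℂ] (Fin 9 → Fin 3 → ℂ) :=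
    { toFun := fun θ i => symMat (a i) *ᵥ θ (a i)
      map_add' := fun θ η => by ext i; simp [mulVec_add]
      map_smul' := fun c θ => by ext i; simp [mulVec_smul] }
  let Ξ : Matrix (Fin 3) (Fin 3) ℂ →ₗ[ℂ] (Fin 9 → Fin 3 → ℂ) :=
    { toFun := fun Z i => Z *ᵥ x i
      map_add' := fun Z Y => by ext i; simp [add_mulVec]
      map_smul' := fun c Z => by ext i; simp [smul_mulVec] }
  have hΞ : Function.Injective Ξ := by
    rw [injective_iff_map_eq_zero]
    intro Z hZ
    ext p j
    exact congrFun (hx (Z p) fun i => congrFun (congrFun hZ i) p) j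
  have hle : Ξ.range ≤ Ψ.range := by
    rintro _ ⟨Z, rfl⟩
    obtain ⟨θ, hθ⟩ := hsolve Z
    exact ⟨θ, funext hθ⟩
  have h9 : 9 ≤ finrank ℂ (Ξ.range.comap Ψ) := by
    have h1 := Submodule.finrank_map_le Ψ (Ξ.range.comap Ψ)
    rw [Submodule.map_comap_eq_of_le hle, LinearMap.finrank_range_of_inj hΞ,
      Module.finrank_matrix] at h1
    simpa using h1
  have h8 := finrank_le_eight_of_radical (Ξ.range.comap Ψ) (fun θ hθ => by
    obtain ⟨Z, hZ⟩ := hθ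
    refine h.rigid θ fun m => ?_
    have hterm : ∀ i, symMat (a i) *ᵥ θ (a i) = Z *ᵥ x i := fun i => (congrFun hZ i).symm
    have hsum : ∑ i, a i m • x i = 0 := by
      ext l
      have := congrFun (hrel l) m
      simp only [Finset.sum_apply, Pi.smul_apply, smul_eq_mul, Pi.zero_apply] at this ⊢
      rw [← this]
      exact Finset.sum_congr rfl fun i _ => mul_comm _ _
    simp only [hterm, ← mulVec_smul]
    rw [← mulVec_sum, hsum, mulVec_zero])
  omega

end IsRigidFamily

theorem dotProduct_mulVec_comm_of_transpose_eq {n : ℕ} {M : Matrix (Fin n) (Fin n) ℂ}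
    (hM : Mᵀ = M) (x y : Fin n → ℂ) : x ⬝ᵥ M *ᵥ y = y ⬝ᵥ M *ᵥ x := by
  rw [dotProduct_mulVec, ← mulVec_transpose, hM, dotProduct_comm]

theorem exists_eq_smul_vecMulVec {n : ℕ} {M : Matrix (Fin n) (Fin n) ℂ} {u : Fin n → ℂ}
    (hM : Mᵀ = M) (hu : u ≠ 0) (h : ∀ w, u ⬝ᵥ w = 0 → M *ᵥ w = 0) :
    ∃ c : ℂ, M = c • vecMulVec u u := by
  obtain ⟨f, hf⟩ := exists_dotProduct_ne_zero hu
  have hMv : ∀ v, M *ᵥ v = ((u ⬝ᵥ v) / (u ⬝ᵥ f)) • M *ᵥ f := fun v => by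
    have h1 := h (v - ((u ⬝ᵥ v) / (u ⬝ᵥ f)) • f) (by
      rw [dotProduct_sub, dotProduct_smul, smul_eq_mul, div_mul_cancel₀ _ hf, sub_self])
    rw [mulVec_sub, mulVec_smul, sub_eq_zero] at h1
    exact h1
  have hMf : M *ᵥ f = ((f ⬝ᵥ M *ᵥ f) / (u ⬝ᵥ f)) • u := by
    ext i
    have h1 := dotProduct_mulVec_comm_of_transpose_eq hM (Pi.single i 1) f
    rw [hMv (Pi.single i 1), dotProduct_smul] at h1
    simp only [single_dotProduct, dotProduct_single, one_mul, mul_one, smul_eq_mul] at h1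
    rw [h1, Pi.smul_apply, smul_eq_mul]
    ring
  refine ⟨(f ⬝ᵥ M *ᵥ f) / (u ⬝ᵥ f) / (u ⬝ᵥ f), ?_⟩
  refine Matrix.ext_of_mulVec_single fun i => ?_
  rw [hMv, hMf, smul_mulVec, vecMulVec_mulVec, dotProduct_single, mul_one, op_smul_eq_smul,
    smul_smul, smul_smul]
  congr 1
  rw [dotProduct_smul, smul_eq_mul, dotProduct_comm f u]
  field_simp

theorem det_smul_vecMulVec (c : ℂ) (u : Fin 3 → ℂ) : (c • vecMulVec u u).det = 0 := by
  rw [det_smul, det_vecMulVec, mul_zero]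

theorem symMat_mulVec_eq_zero_of_adjugate {a : Fin 6 → ℂ} {c : ℂ} {u : Fin 3 → ℂ} (hc : c ≠ 0)
    (hu : u ≠ 0) (h : adjugate (symMat a) = c • vecMulVec u u) : symMat a *ᵥ u = 0 := by
  have hdet : (symMat a).det = 0 := by
    have h1 := det_adjugate_symMat a
    rw [h, det_smul_vecMulVec] at h1
    exact pow_eq_zero_iff two_ne_zero |>.1 h1.symm
  have h1 := mul_adjugate (symMat a)
  rw [h, hdet, zero_smul, Matrix.mul_smul, mul_vecMulVec] at h1
  exact vecMulVec_eq_zero_left hu ((smul_eq_zero.1 h1).resolve_left hc)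

theorem polarForm_ne_zero {x y : Fin 3 → ℂ} (hx : x ≠ 0) (hy : y ≠ 0) : polarForm x y ≠ 0 := by
  intro h0
  obtain ⟨v, hv, hv'⟩ := exists_dotProduct_ne_zero_and hx hy
  have := polarForm_nu x y v
  rw [h0, LinearMap.zero_apply] at this
  exact mul_ne_zero hv hv' this.symm

namespace IsRigidFamily

variable {a : Fin 9 → Fin 6 → ℂ}

theorem exists_adjugate_ne_smul (h : IsRigidFamily a) (i : Fin 9) :
    ∃ k, ∀ c : ℂ, adjugate (symMat (a k)) ≠ c • adjugate (symMat (a i)) := by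
  by_contra! hk
  exact h.not_adjugates_proportional _ hk

theorem det_ne_zero_of_finrank_two (h : IsRigidFamily a)
    (h2 : finrank ℂ (Submodule.span ℂ (Set.range fun i => adjugate (symMat (a i)))) = 2)
    (i₀ : Fin 9) (h₀ : adjugate (symMat (a i₀)) ≠ 0) : (symMat (a i₀)).det ≠ 0 := by
  intro hdet
  obtain ⟨u, hu, hbu, -⟩ := exists_adjugate_eq_vecMulVec hdet h₀
  obtain ⟨k, hk⟩ := h.exists_adjugate_ne_smul i₀
  have hcomb := exists_eq_smul_add_smul h2.le h₀ hk
  simp only [hbu] at hk hcomb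
  obtain ⟨w, huw, hw⟩ : ∃ w, u ⬝ᵥ w = 0 ∧ adjugate (symMat (a k)) *ᵥ w ≠ 0 := by
    by_contra! hw
    obtain ⟨c, hc⟩ := exists_eq_smul_vecMulVec (adjugate_symMat_transpose (a k)) hu hw
    exact hk c hc
  refine polarForm_ne_zero hw hu (h.dual_eq_zero_of_adjugate_ne_zero fun i hi => ?_)
  obtain ⟨x, y, hxy⟩ := hcomb i
  rw [polarForm_apply]
  by_cases hy : y = 0
  · rw [hy, zero_smul, add_zero] at hxy
    have hx : x ≠ 0 := by
      rintro rfl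
      exact hi (by rw [hxy, zero_smul])
    rw [symMat_mulVec_eq_zero_of_adjugate hx hu hxy, dotProduct_zero]
  · have h1 : w ⬝ᵥ adjugate (symMat (a i)) *ᵥ symMat (a i) *ᵥ u = 0 := by
      rw [mulVec_mulVec, adjugate_mul, smul_mulVec, one_mulVec, dotProduct_smul,
        dotProduct_comm w, huw, smul_zero]
    rw [hxy, add_mulVec, smul_mulVec, smul_mulVec, dotProduct_add, dotProduct_smul,
      dotProduct_smul, vecMulVec_mulVec, op_smul_eq_smul, dotProduct_smul, dotProduct_comm w u, huw,
      smul_zero, smul_zero, zero_add, smul_eq_mul] at h1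
    rw [dotProduct_comm, dotProduct_mulVec_comm_of_transpose_eq (adjugate_symMat_transpose (a k))]
    exact (mul_eq_zero.1 h1).resolve_left hy

theorem exists_mulVec_eq_zero_of_finrank_three (h : IsRigidFamily a)
    (h3 : finrank ℂ (Submodule.span ℂ (Set.range fun i => adjugate (symMat (a i)))) = 3)
    {i₀ : Fin 9} (hdet : (symMat (a i₀)).det = 0) :
    ∃ n : Fin 3 → ℂ, n ≠ 0 ∧ ∀ i, adjugate (symMat (a i)) *ᵥ n = 0 := by
  have h₀ := h.adjugate_ne_zero h3 i₀
  obtain ⟨u, hu, hbu, -⟩ := exists_adjugate_eq_vecMulVec hdet h₀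
  obtain ⟨k, hk⟩ := h.exists_adjugate_ne_smul i₀
  obtain ⟨m, hm, hcomb⟩ := exists_eq_smul_add_smul_add_smul h3 h₀ hk
  obtain ⟨w₁, w₂, f₁, f₂, hw₁, hw₂, h₁₁, h₁₂, h₂₁, h₂₂, hbasis⟩ := exists_basis_orthogonal hu
  simp only [hbu] at hk hm hcomb
  have hsk := adjugate_symMat_transpose (a k)
  have hsm := adjugate_symMat_transpose (a m)
  set β := adjugate (symMat (a k)) with hβ
  set γ := adjugate (symMat (a m)) with hγ
  have hrestrict : ∀ {i} {x y z : ℂ}, adjugate (symMat (a i)) = x • vecMulVec u u + y • β + z • γ →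
      ∀ w, u ⬝ᵥ w = 0 → adjugate (symMat (a i)) *ᵥ w = y • β *ᵥ w + z • γ *ᵥ w :=
    fun hxyz w hw => by
      rw [hxyz, add_mulVec, add_mulVec, smul_mulVec, smul_mulVec, smul_mulVec, vecMulVec_mulVec,
        hw, op_smul_eq_smul, zero_smul, smul_zero, zero_add]
  have hQ : polarForm (β *ᵥ w₁) (γ *ᵥ w₂) - polarForm (β *ᵥ w₂) (γ *ᵥ w₁) = 0 := by
    refine h.dual_eq_zero hu fun i hi => ?_
    obtain ⟨x, y, z, hxyz⟩ := hcomb i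
    have hb : ∀ w v, (adjugate (symMat (a i)) *ᵥ w) ⬝ᵥ symMat (a i) *ᵥ v =
        (symMat (a i)).det * (w ⬝ᵥ v) := fun w v => by
      rw [dotProduct_comm,
        dotProduct_mulVec_comm_of_transpose_eq (adjugate_symMat_transpose (a i)), mulVec_mulVec,
        adjugate_mul, smul_mulVec, one_mulVec, dotProduct_smul, smul_eq_mul]
    have hA := dotProduct_mulVec_comm_of_transpose_eq (symMat_transpose (a i))
    have e₁ := hrestrict hxyz w₁ hw₁
    have e₂ := hrestrict hxyz w₂ hw₂
    rw [LinearMap.sub_apply, polarForm_apply, polarForm_apply]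
    by_cases hy : y = 0
    · by_cases hz : z = 0
      · rw [hy, hz, zero_smul, zero_smul, add_zero, add_zero] at hxyz
        have hx : x ≠ 0 := by
          rintro rfl
          exact h.adjugate_ne_zero h3 i (by rw [hxyz, zero_smul])
        exact absurd (symMat_mulVec_eq_zero_of_adjugate hx hu hxyz) hi
      · have b₁ := hb w₁ (β *ᵥ w₂)
        have b₂ := hb w₂ (β *ᵥ w₁)
        rw [e₁, add_dotProduct, smul_dotProduct, smul_dotProduct, smul_eq_mul, smul_eq_mul] at b₁
        rw [e₂, add_dotProduct, smul_dotProduct, smul_dotProduct, smul_eq_mul, smul_eq_mul] at b₂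
        refine (mul_eq_zero.1 ?_).resolve_left hz
        rw [hA (β *ᵥ w₁) (γ *ᵥ w₂), hA (β *ᵥ w₂) (γ *ᵥ w₁)]
        have c₁ := dotProduct_mulVec_comm_of_transpose_eq hsk w₁ w₂
        have c₂ := hA (β *ᵥ w₁) (β *ᵥ w₂)
        linear_combination b₂ - b₁ - (symMat (a i)).det * c₁ + y * c₂
    · have b₁ := hb w₁ (γ *ᵥ w₂)
      have b₂ := hb w₂ (γ *ᵥ w₁)
      rw [e₁, add_dotProduct, smul_dotProduct, smul_dotProduct, smul_eq_mul, smul_eq_mul] at b₁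
      rw [e₂, add_dotProduct, smul_dotProduct, smul_dotProduct, smul_eq_mul, smul_eq_mul] at b₂
      refine (mul_eq_zero.1 ?_).resolve_left hy
      have c₁ := dotProduct_mulVec_comm_of_transpose_eq hsm w₁ w₂
      have c₂ := hA (γ *ᵥ w₁) (γ *ᵥ w₂)
      linear_combination b₁ - b₂ + (symMat (a i)).det * c₁ - z * c₂
  rcases proportional_of_det_eq_zero (p₁ := β *ᵥ w₁) (p₂ := β *ᵥ w₂) (q₁ := γ *ᵥ w₁)
      (q₂ := γ *ᵥ w₂) (fun v => by
        rw [← polarForm_nu, ← polarForm_nu]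
        exact congrArg (· (nu v)) (sub_eq_zero.1 hQ)) with
    ⟨s, t, hst, hp, hq⟩ | ⟨s, t, hst, hp, hq⟩
  · refine ⟨s • w₁ + t • w₂, fun h0 => ?_, fun i => ?_⟩
    · have e₁ := congrArg (f₁ ⬝ᵥ ·) h0
      have e₂ := congrArg (f₂ ⬝ᵥ ·) h0
      simp only [dotProduct_add, dotProduct_smul, h₁₁, h₁₂, h₂₁, h₂₂, smul_eq_mul, mul_one,
        mul_zero, add_zero, zero_add, dotProduct_zero] at e₁ e₂
      exact hst.elim (· e₁) (· e₂)
    · obtain ⟨x, y, z, hxyz⟩ := hcomb i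
      rw [hrestrict hxyz _ (by simp [dotProduct_add, hw₁, hw₂]), mulVec_add, mulVec_add,
        mulVec_smul, mulVec_smul, mulVec_smul, mulVec_smul, hp, hq, smul_zero, smul_zero, add_zero]
  · exfalso
    obtain ⟨c, hc⟩ := exists_eq_smul_vecMulVec (M := s • β + t • γ) (u := u)
      (by rw [transpose_add, transpose_smul, transpose_smul, hsk, hsm]) hu (fun w hw => by
        rw [hbasis w hw, add_mulVec, smul_mulVec, smul_mulVec, mulVec_add, mulVec_add,
          mulVec_smul, mulVec_smul, mulVec_smul, mulVec_smul]
        trans (f₁ ⬝ᵥ w) • (s • β *ᵥ w₁ + t • γ *ᵥ w₁) + (f₂ ⬝ᵥ w) • (s • β *ᵥ w₂ + t • γ *ᵥ w₂)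
        · module
        · rw [hp, hq, smul_zero, smul_zero, add_zero])
    by_cases ht : t = 0
    · rw [ht, zero_smul, add_zero] at hc
      have hs : s ≠ 0 := hst.resolve_right (not_not.2 ht)
      exact hk (s⁻¹ * c) (by rw [mul_smul, ← hc, smul_smul, inv_mul_cancel₀ hs, one_smul])
    · refine hm (t⁻¹ * c) (-(t⁻¹ * s)) ?_
      rw [mul_smul, ← hc, smul_add, smul_smul, smul_smul, inv_mul_cancel₀ ht, one_smul]
      module

theorem sum_dotProduct_mul_dotProduct_smul (h : IsRigidFamily a) {u : Fin 9 → Fin 3 → ℂ}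
    (hu : ∀ i, adjugate (symMat (a i)) = vecMulVec (u i) (u i)) (x y : Fin 3 → ℂ) :
    ∑ i, ((x ⬝ᵥ u i) * (y ⬝ᵥ u i)) • a i = 0 := by
  let ψ : Dual ℂ (Matrix (Fin 3) (Fin 3) ℂ) :=
    { toFun := fun M => x ⬝ᵥ M *ᵥ y
      map_add' := fun M N => by rw [add_mulVec, dotProduct_add]
      map_smul' := fun c M => by rw [smul_mulVec, dotProduct_smul, RingHom.id_apply] }
  rw [← h.relation ψ]
  refine Finset.sum_congr rfl fun i _ => ?_
  congr 1
  change _ = x ⬝ᵥ adjugate (symMat (a i)) *ᵥ y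
  rw [hu i, vecMulVec_mulVec, op_smul_eq_smul, dotProduct_smul, smul_eq_mul, dotProduct_comm y,
    mul_comm]

theorem det_ne_zero_of_finrank_three (h : IsRigidFamily a)
    (h3 : finrank ℂ (Submodule.span ℂ (Set.range fun i => adjugate (symMat (a i)))) = 3)
    (i₀ : Fin 9) : (symMat (a i₀)).det ≠ 0 := by
  intro hdet₀
  obtain ⟨n, hn, hbn⟩ := h.exists_mulVec_eq_zero_of_finrank_three h3 hdet₀
  have hdet : ∀ i, (symMat (a i)).det = 0 := fun i => by
    have h1 := exists_mulVec_eq_zero_iff.1 ⟨n, hn, hbn i⟩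
    rw [det_adjugate_symMat] at h1
    exact pow_eq_zero_iff two_ne_zero |>.1 h1
  choose u hu hb hAu using fun i =>
    exists_adjugate_eq_vecMulVec (hdet i) (h.adjugate_ne_zero h3 i)
  have hnu : ∀ i, n ⬝ᵥ u i = 0 := fun i => by
    have h1 := hbn i
    rw [hb i, vecMulVec_mulVec, op_smul_eq_smul] at h1
    rw [dotProduct_comm]
    exact (smul_eq_zero.1 h1).resolve_right (hu i)
  obtain ⟨k, hk⟩ := h.exists_adjugate_ne_smul i₀
  obtain ⟨m, hm, -⟩ := exists_eq_smul_add_smul_add_smul h3 (h.adjugate_ne_zero h3 i₀) hk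
  simp only [hb] at hk hm
  have huk : ∀ c : ℂ, u k ≠ c • u i₀ := fun c hc => hk (c * c) (by
    rw [hc, smul_vecMulVec, vecMulVec_smul, smul_smul])
  obtain ⟨f, g, hg₀, hgk, hf₀, hfk, hdecomp⟩ := exists_dual_pair hn (hnu i₀) (hnu k) (hu i₀) huk
  have hui : ∀ i, u i = (g ⬝ᵥ u i) • u i₀ + (f ⬝ᵥ u i) • u k := fun i => hdecomp _ (hnu i)
  have hrel := h.sum_dotProduct_mul_dotProduct_smul hb
  generalize hp : (fun i => g ⬝ᵥ u i) = p
  generalize hr : (fun i => f ⬝ᵥ u i) = r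
  have hp' : ∀ i, g ⬝ᵥ u i = p i := fun i => congrFun hp i
  have hr' : ∀ i, f ⬝ᵥ u i = r i := fun i => congrFun hr i
  simp only [hp', hr'] at hui hg₀ hgk hf₀ hfk
  have hpp := hrel g g
  have hpr := hrel g f
  have hrr := hrel f f
  simp only [hp', hr'] at hpp hpr hrr
  have hpm : p m ≠ 0 := fun h0 => hm 0 (r m * r m) (by
    rw [hui m, h0, zero_smul, zero_add, smul_vecMulVec, vecMulVec_smul, smul_smul, zero_smul,
      zero_add])
  have hrm : r m ≠ 0 := fun h0 => hm (p m * p m) 0 (by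
    rw [hui m, h0, zero_smul, add_zero, smul_vecMulVec, vecMulVec_smul, smul_smul, zero_smul,
      add_zero])
  let I : Finset (Fin 9) := Finset.univ.filter fun i => r i ≠ 0
  have hI : ∀ {i}, i ∈ I ↔ r i ≠ 0 := fun {i} => by simp [I]
  have h6 := h.finrank_span (hu i₀) I (fun i hi => by
    have h0 : r i = 0 := by simpa [hI] using hi
    have h1 := hui i
    rw [h0, zero_smul, add_zero] at h1
    have h2 := hAu i
    rw [h1, mulVec_smul] at h2
    refine (smul_eq_zero.1 h2).resolve_left fun h3 => hu i ?_
    rw [h1, h3, zero_smul])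
  let b : Fin 9 → Fin 2 → ℂ := fun i => ![r i * p i, r i * r i]
  have hbI : ∀ i ∉ I, b i = 0 := fun i hi => by
    have h0 : r i = 0 := by simpa [hI] using hi
    simp [b, h0]
  have hψ : ∀ (ψ : Dual ℂ (Fin 2 → ℂ)) i, ψ (b i) =
      ψ (Pi.single 0 1) * (r i * p i) + ψ (Pi.single 1 1) * (r i * r i) := fun ψ i => by
    have : b i = (r i * p i) • Pi.single 0 1 + (r i * r i) • Pi.single 1 1 := by
      ext j
      fin_cases j <;> simp [b]
    rw [this, map_add, map_smul, map_smul, smul_eq_mul, smul_eq_mul, mul_comm,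
      mul_comm (r i * r i)]
  have hbrel : ∀ ψ : Dual ℂ (Fin 2 → ℂ), ∑ i, ψ (b i) • a i = 0 := fun ψ => by
    simp only [hψ, add_smul, mul_smul (ψ _), Finset.sum_add_distrib, ← Finset.smul_sum,
      hrr, smul_zero, add_zero, mul_comm (r _) (p _), hpr]
  have h2 : finrank ℂ (Submodule.span ℂ (Set.range b)) = 2 := by
    have hli : LinearIndependent ℂ ![b k, b m] := by
      rw [LinearIndependent.pair_iff]
      intro s t hst
      have e₀ := congrFun hst 0
      have e₁ := congrFun hst 1
      simp only [b, hgk, hfk, Pi.add_apply, Pi.smul_apply, cons_val_zero, cons_val_one,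
        smul_eq_mul, mul_zero, mul_one, zero_add, Pi.zero_apply] at e₀ e₁
      have ht : t = 0 := (mul_eq_zero.1 e₀).resolve_right (mul_ne_zero hrm hpm)
      rw [ht, zero_mul, add_zero] at e₁
      exact ⟨e₁, ht⟩
    refine le_antisymm ((Submodule.finrank_le _).trans (by simp)) ?_
    have h1 := finrank_span_eq_card hli
    rw [Fintype.card_fin] at h1
    refine h1.symm.le.trans (Submodule.finrank_mono (Submodule.span_mono ?_))
    rintro _ ⟨j, rfl⟩
    fin_cases j
    exacts [⟨k, rfl⟩, ⟨m, rfl⟩]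
  have hcard := finrank_span_restrict_add_le I hbI hbrel
  rw [h6, h2] at hcard
  have hi₀ : i₀ ∉ I := fun hi => hI.1 hi hf₀
  have hIe : I = Finset.univ.erase i₀ :=
    Finset.eq_of_subset_of_card_le (fun i hi => Finset.mem_erase.2
      ⟨fun hii => hi₀ (hii ▸ hi), Finset.mem_univ _⟩) (by simpa using hcard)
  have hIi₀ : ∀ i, i ∉ I → i = i₀ := fun i hi => by simpa [hIe] using hi
  obtain ⟨y, hy, hyu⟩ := exists_orthogonal_not_smul (symMat (a i₀) *ᵥ u k) (u i₀)
  have hq₀ : polarForm (u k) y (a i₀) = 0 := by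
    rw [polarForm_apply, dotProduct_mulVec_comm_of_transpose_eq (symMat_transpose _),
      dotProduct_comm, hy]
  generalize hq₂ : polarForm (u k) y = q₂ at hq₀
  obtain ⟨q₁, hq₁⟩ := exists_dual_apply_eq (fun i : I => a i)
      (fun i => p i / r i * q₂ (a i)) (fun κ hκ => by
    obtain ⟨ψ, hψκ⟩ := exists_dual_of_relation (sum_subtype_smul_eq I hbI hbrel) (by
      rw [h6, span_range_restrict I hbI, h2, Fintype.card_coe, hIe]
      simp) κ hκ
    have hterm : ∀ i : I, κ i * (p i / r i * q₂ (a i)) =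
        (ψ (Pi.single 0 1) * (p i * p i) + ψ (Pi.single 1 1) * (p i * r i)) * q₂ (a i) :=
      fun i => by
        have hri := hI.1 i.2
        rw [hψκ i, hψ]
        field_simp
    simp only [hterm]
    rw [Finset.sum_coe_sort I (fun i => (ψ (Pi.single 0 1) * (p i * p i) +
        ψ (Pi.single 1 1) * (p i * r i)) * q₂ (a i)),
      Finset.sum_subset (Finset.subset_univ I) (fun i _ hi => by
        rw [hIi₀ i hi, hq₀, mul_zero])]
    have h0 := congrArg q₂ (congrArg₂ (fun v w => ψ (Pi.single 0 1) • v + ψ (Pi.single 1 1) • w)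
      hpp hpr)
    simp only [smul_zero, add_zero, map_zero, map_add, map_smul, map_sum, smul_eq_mul,
      Finset.mul_sum, ← Finset.sum_add_distrib] at h0
    rw [← h0]
    exact Finset.sum_congr rfl fun i _ => by ring)
  have hθ := h.radical (θ := q₁.smulRight (u i₀) + q₂.smulRight (u k)) (fun i => by
    simp only [LinearMap.add_apply, LinearMap.smulRight_apply]
    by_cases hi : i ∈ I
    · have h1 : q₁ (a i) • u i₀ + q₂ (a i) • u k = (q₂ (a i) / r i) • u i := by
        have hri := hI.1 hi
        rw [hq₁ ⟨i, hi⟩, hui i, smul_add, smul_smul, smul_smul, div_mul_cancel₀ _ hri]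
        congr 2
        ring
      rw [h1, mulVec_smul, hAu, smul_zero]
    · rw [hIi₀ i hi, hq₀, zero_smul, add_zero, mulVec_smul, hAu, smul_zero])
  obtain ⟨v, hv₀, hvk, hvy⟩ := exists_dotProduct_eq_zero_ne_zero_and huk hyu
  have h0 := hθ v
  rw [LinearMap.add_apply, LinearMap.smulRight_apply, LinearMap.smulRight_apply, dotProduct_add,
    dotProduct_smul, dotProduct_smul, dotProduct_comm v, hv₀, smul_zero, zero_add, ← hq₂,
    polarForm_nu, dotProduct_comm v, smul_eq_mul] at h0
  exact mul_ne_zero (mul_ne_zero hvk hvy) hvk h0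

end IsRigidFamily

theorem not_isRigidFamily (a : Fin 9 → Fin 6 → ℂ) : ¬ IsRigidFamily a := by
  intro h
  rcases h.two_le_finrank_adjugate.eq_or_lt with h2 | h2
  · exact h.not_det_ne_zero_of_finrank_two (h.det_ne_zero_of_finrank_two h2.symm) h2.symm
  · have h3 := le_antisymm h.finrank_adjugate_le h2
    exact h.not_det_ne_zero_of_finrank_three (h.det_ne_zero_of_finrank_three h3) h3

/-- The product of the factorials of the exponents of a monomial. -/
def expFactorial {n : ℕ} (d : Fin n →₀ ℕ) : ℕ := ∏ i, (d i).factorial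

theorem expFactorial_add_single {n : ℕ} (d : Fin n →₀ ℕ) (i : Fin n) :
    expFactorial (d + Finsupp.single i 1) = expFactorial d * (d i + 1) := by
  have h : ∀ j, ((d + Finsupp.single i 1 : Fin n →₀ ℕ) j).factorial =
      (d j).factorial * if j = i then d i + 1 else 1 := fun j => by
    by_cases hj : j = i
    · subst hj
      simp [Nat.factorial_succ, mul_comm]
    · simp [hj]
  simp only [expFactorial, h, Finset.prod_mul_distrib, Finset.prod_ite_eq', Finset.mem_univ,
    if_true]

theorem prod_pow_add_single {n : ℕ} (a : Fin n → ℂ) (d : Fin n →₀ ℕ) (i : Fin n) :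
    ∏ j, a j ^ (d + Finsupp.single i 1 : Fin n →₀ ℕ) j = (∏ j, a j ^ d j) * a i := by
  have h : ∀ j, a j ^ (d + Finsupp.single i 1 : Fin n →₀ ℕ) j = a j ^ d j * if j = i then a i else 1 :=
    fun j => by
      by_cases hj : j = i
      · subst hj
        simp [pow_succ]
      · simp [hj]
  simp only [h, Finset.prod_mul_distrib, Finset.prod_ite_eq', Finset.mem_univ, if_true]

theorem exists_eq_add_single_of_degree_eq_succ {n r : ℕ} {d : Fin n →₀ ℕ}
    (hd : d.degree = r + 1) : ∃ e i, d = e + Finsupp.single i 1 ∧ e.degree = r := by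
  obtain ⟨i, hi⟩ : ∃ i, d i ≠ 0 := by
    by_contra! h0
    rw [Finsupp.degree_eq_sum, Finset.sum_eq_zero fun i _ => h0 i] at hd
    omega
  have hle : Finsupp.single i 1 ≤ d := by
    rw [Finsupp.single_le_iff]
    omega
  refine ⟨d - Finsupp.single i 1, i, (tsub_add_cancel_of_le hle).symm, ?_⟩
  have h1 := congrArg Finsupp.degree (tsub_add_cancel_of_le hle)
  rw [map_add, Finsupp.degree_single, hd] at h1
  omega

theorem coeff_pderiv_pow {n : ℕ} (i : Fin n) (k : ℕ) (f : MvPolynomial (Fin n) ℂ)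
    (m : Fin n →₀ ℕ) :
    coeff m ((((pderiv (R := ℂ) i).toLinearMap : Module.End ℂ (MvPolynomial (Fin n) ℂ)) ^ k) f) =
      coeff (m + Finsupp.single i k) f * ((m i + 1).ascFactorial k : ℂ) := by
  induction k generalizing f with
  | zero => simp
  | succ k ih =>
    rw [pow_succ, Module.End.mul_apply, ih]
    change coeff _ (pderiv i f) * _ = _
    rw [coeff_pderiv, add_assoc, ← Finsupp.single_add, Nat.ascFactorial_succ]
    simp only [Finsupp.add_apply, Finsupp.single_eq_same]
    push_cast
    ring

theorem coeff_list_prod_pderiv {n : ℕ} (d : Fin n →₀ ℕ) (f : MvPolynomial (Fin n) ℂ)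
    (l : List (Fin n)) (hl : l.Nodup) (m : Fin n →₀ ℕ) (hm : ∀ i ∈ l, m i = 0) :
    coeff m ((l.map fun i =>
      ((pderiv (R := ℂ) i).toLinearMap : Module.End ℂ (MvPolynomial (Fin n) ℂ)) ^ (d i)).prod f) =
      coeff (m + (l.map fun i => Finsupp.single i (d i)).sum) f *
        ((l.map fun i => (d i).factorial).prod : ℕ) := by
  induction l generalizing m with
  | nil => simp
  | cons i l ih =>
    obtain ⟨hi, hl⟩ := List.nodup_cons.1 hl
    rw [List.map_cons, List.prod_cons, Module.End.mul_apply, coeff_pderiv_pow,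
      hm i List.mem_cons_self, zero_add, Nat.one_ascFactorial, ih hl, List.map_cons, List.sum_cons,
      List.map_cons, List.prod_cons, add_assoc]
    · push_cast
      ring
    · intro j hj
      have hij : i ≠ j := fun h => hi (h ▸ hj)
      simp [hm j (List.mem_cons_of_mem _ hj), hij]

theorem eval_zero_monOp {n : ℕ} (d : Fin n →₀ ℕ) (f : MvPolynomial (Fin n) ℂ) :
    eval (fun _ => (0 : ℂ)) (monOp d f) = expFactorial d * coeff d f := by
  have h := coeff_list_prod_pderiv d f (List.finRange n) (List.nodup_finRange n) 0 (by simp)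
  rw [← List.ofFn_eq_map, ← List.ofFn_eq_map, ← List.ofFn_eq_map, List.sum_ofFn, List.prod_ofFn,
    Finsupp.univ_sum_single, zero_add, mul_comm] at h
  rw [MvPolynomial.eval_zero', constantCoeff_eq]
  exact h

/-- The apolarity pairing with `f` as a linear form. -/
noncomputable def apolarForm {n : ℕ} (f : MvPolynomial (Fin n) ℂ) :
    MvPolynomial (Fin n) ℂ →ₗ[ℂ] ℂ :=
  (basisMonomials (Fin n) ℂ).constr ℂ fun d => expFactorial d * coeff d f

theorem apolarForm_monomial {n : ℕ} (f : MvPolynomial (Fin n) ℂ) (d : Fin n →₀ ℕ) (c : ℂ) :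
    apolarForm f (monomial d c) = c * (expFactorial d * coeff d f) := by
  have h : monomial d c = c • basisMonomials (Fin n) ℂ d := by
    rw [coe_basisMonomials, smul_monomial, smul_eq_mul, mul_one]
  rw [h, map_smul, apolarForm, Basis.constr_basis, smul_eq_mul]

theorem pairing_eq_apolarForm {n : ℕ} (f k : MvPolynomial (Fin n) ℂ) :
    pairing f k = apolarForm f k := by
  conv_rhs => rw [k.as_sum]
  rw [pairing, apolar, map_sum, map_sum]
  refine Finset.sum_congr rfl fun d _ => ?_
  rw [smul_eval, eval_zero_monOp, apolarForm_monomial]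

theorem apolarForm_sum {n : ℕ} {ι : Type*} (s : Finset ι) (f : ι → MvPolynomial (Fin n) ℂ)
    (k : MvPolynomial (Fin n) ℂ) : apolarForm (∑ i ∈ s, f i) k = ∑ i ∈ s, apolarForm (f i) k := by
  rw [k.as_sum]
  simp only [map_sum, apolarForm_monomial, coeff_sum, Finset.mul_sum]
  exact Finset.sum_comm

theorem expFactorial_mul_coeff_linForm_pow {n : ℕ} (a : Fin n → ℂ) (r : ℕ) (d : Fin n →₀ ℕ)
    (hd : d.degree = r) :
    expFactorial d * coeff d (linForm a ^ r) = r.factorial * ∏ i, a i ^ d i := by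
  induction r generalizing d with
  | zero =>
    rw [Finsupp.degree_eq_zero_iff] at hd
    subst hd
    simp [expFactorial]
  | succ r ih =>
    obtain ⟨e, i, rfl, he⟩ := exists_eq_add_single_of_degree_eq_succ hd
    have hpd : pderiv i (linForm a ^ (r + 1)) = C ((r + 1) * a i) * linForm a ^ r := by
      rw [Derivation.leibniz_pow]
      simp [linForm, Pi.single_apply]
      ring
    have h1 := coeff_pderiv (i := i) (linForm a ^ (r + 1)) e
    rw [hpd, coeff_C_mul] at h1
    rw [expFactorial_add_single, prod_pow_add_single, Nat.factorial_succ]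
    push_cast
    linear_combination (r + 1) * a i * ih e he - expFactorial e * h1

theorem apolarForm_linForm_pow {n r : ℕ} (a : Fin n → ℂ) {k : MvPolynomial (Fin n) ℂ}
    (hk : k.IsHomogeneous r) : apolarForm (linForm a ^ r) k = r.factorial * eval a k := by
  rw [k.as_sum, map_sum, map_sum, Finset.mul_sum]
  refine Finset.sum_congr rfl fun d hd => ?_
  have hd' : d.degree = r := by
    by_contra h
    exact (mem_support_iff.1 hd) (hk.coeff_eq_zero h)
  rw [apolarForm_monomial, expFactorial_mul_coeff_linForm_pow a r d hd', eval_monomial,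
    Finsupp.prod_fintype _ _ (by simp)]
  ring

/-- The exponents of the monomials of degree three in three variables. -/
noncomputable abbrev cubicExponents : Finset (Fin 3 →₀ ℕ) := Finset.univ.finsuppAntidiag 3

theorem mem_cubicExponents {d : Fin 3 →₀ ℕ} : d ∈ cubicExponents ↔ d.degree = 3 := by
  simp [cubicExponents, Finsupp.degree_eq_sum]

/-- The matrix of the pairing that a ternary sextic induces on ternary cubics. -/
noncomputable def catalecticant (g : MvPolynomial (Fin 3) ℂ) :
    Matrix cubicExponents cubicExponents ℂ :=
  .of fun d e => expFactorial (d.1 + e.1) * coeff (d.1 + e.1) g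

/-- The determinant of the catalecticant as a polynomial in the coefficients of the sextic. -/
noncomputable def catalecticantDet : MvPolynomial (Fin 3 →₀ ℕ) ℂ :=
  det (.of fun d e : cubicExponents => C (expFactorial (d.1 + e.1) : ℂ) * X (d.1 + e.1))

theorem evalCoeff_catalecticantDet (g : MvPolynomial (Fin 3) ℂ) :
    evalCoeff g catalecticantDet = (catalecticant g).det := by
  rw [evalCoeff, catalecticantDet, RingHom.map_det]
  congr 1
  ext d e
  simp [catalecticant]

theorem eq_sum_cubicExponents {c : MvPolynomial (Fin 3) ℂ} (hc : c.IsHomogeneous 3) :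
    c = ∑ d : cubicExponents, monomial d.1 (coeff d.1 c) := by
  rw [Finset.sum_coe_sort cubicExponents fun d => monomial d (coeff d c)]
  conv_lhs => rw [c.as_sum]
  refine Finset.sum_subset (fun d hd => ?_) fun d _ hd => ?_
  · rw [mem_cubicExponents]
    by_contra h
    exact mem_support_iff.1 hd (hc.coeff_eq_zero h)
  · rw [notMem_support_iff.1 hd, monomial_zero]

theorem eq_zero_of_apolarForm_mul_eq_zero {g c : MvPolynomial (Fin 3) ℂ}
    (hg : (catalecticant g).det ≠ 0) (hc : c.IsHomogeneous 3)
    (h : ∀ d : Fin 3 →₀ ℕ, d.degree = 3 → apolarForm g (monomial d 1 * c) = 0) : c = 0 := by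
  have h0 := eq_zero_of_mulVec_eq_zero hg (v := fun d => coeff d.1 c) (by
    ext d
    have h1 := h d (mem_cubicExponents.1 d.2)
    rw [eq_sum_cubicExponents hc, Finset.mul_sum, map_sum] at h1
    simp only [monomial_mul, one_mul, apolarForm_monomial] at h1
    rw [Pi.zero_apply, ← h1]
    simp only [mulVec, dotProduct]
    exact Finset.sum_congr rfl fun e _ => mul_comm _ _)
  rw [eq_sum_cubicExponents hc]
  refine Finset.sum_eq_zero fun d _ => ?_
  rw [congrFun h0 d, Pi.zero_apply, monomial_zero]

theorem isHomogeneous_linForm_pow {n : ℕ} (a : Fin n → ℂ) (r : ℕ) :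
    (linForm a ^ r).IsHomogeneous r := by
  have h : (linForm a).IsHomogeneous 1 :=
    IsHomogeneous.sum _ _ _ fun i _ => isHomogeneous_C_mul_X _ _
  simpa using h.pow r

open ComplexOrder in
theorem exists_catalecticant_det_ne_zero :
    ∃ g : MvPolynomial (Fin 3) ℂ, g.IsHomogeneous 6 ∧ (catalecticant g).det ≠ 0 := by
  let w : (Fin 3 → Fin 4) → Fin 3 → ℂ := fun t i => (t i : ℕ)
  refine ⟨∑ t, linForm (w t) ^ 6, IsHomogeneous.sum _ _ _ fun t _ =>
    isHomogeneous_linForm_pow _ _, fun hdet => ?_⟩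
  obtain ⟨v, hv, h0⟩ := exists_mulVec_eq_zero_iff.2 hdet
  let c : MvPolynomial (Fin 3) ℂ := ∑ d : cubicExponents, monomial d.1 (v d)
  have hcoeff : ∀ d : cubicExponents, coeff d.1 c = v d := fun d => by
    simp only [c, coeff_sum, coeff_monomial, Subtype.coe_inj]
    simp
  have hentry : ∀ d e : cubicExponents, catalecticant (∑ t, linForm (w t) ^ 6) d e =
      720 * ∑ t, (∏ i, w t i ^ d.1 i) * ∏ i, w t i ^ e.1 i := fun d e => by
    have hde : (d.1 + e.1).degree = 6 := by
      rw [map_add, mem_cubicExponents.1 d.2, mem_cubicExponents.1 e.2]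
    rw [catalecticant, of_apply, coeff_sum, Finset.mul_sum, Finset.mul_sum]
    refine Finset.sum_congr rfl fun t _ => ?_
    rw [expFactorial_mul_coeff_linForm_pow _ _ _ hde]
    simp only [Finsupp.add_apply, pow_add, Finset.prod_mul_distrib]
    norm_num [Nat.factorial]
  have heval : ∀ t, eval (w t) c = ∑ d : cubicExponents, v d * ∏ i, w t i ^ d.1 i := fun t => by
    simp only [c, map_sum, eval_monomial, Finsupp.prod_fintype, pow_zero, implies_true]
  have hreal : ∀ t (d : cubicExponents), star (∏ i, w t i ^ d.1 i) = ∏ i, w t i ^ d.1 i :=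
    fun t d => by simp [w]
  have hmul : ∀ d, (catalecticant (∑ t, linForm (w t) ^ 6) *ᵥ v) d =
      720 * ∑ t, (∏ i, w t i ^ d.1 i) * eval (w t) c := fun d => by
    simp only [mulVec, dotProduct, hentry, heval, Finset.mul_sum, Finset.sum_mul]
    rw [Finset.sum_comm]
    refine Finset.sum_congr rfl fun t _ => Finset.sum_congr rfl fun e _ => ?_
    ring
  have hsum : ∑ t, star (eval (w t) c) * eval (w t) c = 0 := by
    have h1 : ∀ d : cubicExponents, ∑ t, (∏ i, w t i ^ d.1 i) * eval (w t) c = 0 := fun d => by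
      have h2 := hmul d
      rw [h0, Pi.zero_apply, eq_comm] at h2
      exact (mul_eq_zero.1 h2).resolve_left (by norm_num)
    have h2 : ∀ t, star (eval (w t) c) * eval (w t) c =
        ∑ d : cubicExponents, star (v d) * ((∏ i, w t i ^ d.1 i) * eval (w t) c) := fun t => by
      conv_lhs => rw [heval t, star_sum, Finset.sum_mul]
      refine Finset.sum_congr rfl fun d _ => ?_
      rw [star_mul', hreal, ← heval, mul_assoc]
    simp only [h2]
    rw [Finset.sum_comm]
    refine Finset.sum_eq_zero fun d _ => ?_
    rw [← Finset.mul_sum, h1, mul_zero]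
  have hzero : ∀ t, eval (w t) c = 0 := fun t => by
    have h1 := (Finset.sum_eq_zero_iff_of_nonneg fun t _ =>
      star_mul_self_nonneg (eval (w t) c)).1 hsum t (Finset.mem_univ _)
    simpa using h1
  have hhom : c.IsHomogeneous 3 := IsHomogeneous.sum _ _ _ fun d _ =>
    isHomogeneous_monomial _ (mem_cubicExponents.1 d.2)
  have hc : c = 0 := by
    refine eq_zero_of_eval_zero_at_prod_finset c
      (fun _ => Finset.univ.image fun t : Fin 4 => ((t : ℕ) : ℂ)) (fun i => ?_) fun x hx => ?_
    · rw [Finset.card_image_of_injective _ fun s t h => Fin.ext (Nat.cast_injective h),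
        Finset.card_univ, Fintype.card_fin, degreeOf_lt_iff (by norm_num)]
      intro d hd
      have h3 : d.degree = 3 := by
        by_contra h
        exact mem_support_iff.1 hd (hhom.coeff_eq_zero h)
      have := Finsupp.le_degree i d
      omega
    · choose t _ ht using fun i => Finset.mem_image.1 (hx i)
      rw [← hzero t]
      congr
      exact (funext ht).symm
  refine hv (funext fun d => ?_)
  rw [← hcoeff d, hc, coeff_zero, Pi.zero_apply]

/-- The symmetric matrix of coordinate forms specializing to `symMat`. -/
noncomputable def symMatPoly : Matrix (Fin 3) (Fin 3) (MvPolynomial (Fin 6) ℂ) :=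
  !![X 0, C 2⁻¹ * X 1, C 2⁻¹ * X 2; C 2⁻¹ * X 1, X 3, C 2⁻¹ * X 4;
    C 2⁻¹ * X 2, C 2⁻¹ * X 4, X 5]

theorem isHomogeneous_symMatPoly (p q : Fin 3) : (symMatPoly p q).IsHomogeneous 1 := by
  fin_cases p <;> fin_cases q <;>
    first
    | exact isHomogeneous_X _ _
    | exact isHomogeneous_C_mul_X _ _

theorem eval_symMatPoly (a : Fin 6 → ℂ) : (eval a).mapMatrix symMatPoly = symMat a := by
  ext p q
  fin_cases p <;> fin_cases q <;> simp [symMatPoly, symMat_apply] <;> ring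

theorem eval_nuPoly (x : Fin 3 → ℂ) (m : Fin 6) : eval x (nuPoly m) = nu x m := by
  fin_cases m <;> simp [nuPoly, nu]

theorem eval_aeval_nuPoly (x : Fin 3 → ℂ) (k : MvPolynomial (Fin 6) ℂ) :
    eval x (aeval nuPoly k) = eval (nu x) k := by
  rw [← aeval_eq_eval, ← aeval_eq_eval, comp_aeval_apply]
  simp only [aeval_eq_eval, eval_nuPoly]

theorem isHomogeneous_nuPoly (m : Fin 6) : (nuPoly m).IsHomogeneous 2 := by
  have hsq : ∀ i : Fin 3, (X i ^ 2 : MvPolynomial (Fin 3) ℂ).IsHomogeneous 2 := fun i =>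
    isHomogeneous_X_pow i 2
  have hmul : ∀ i j : Fin 3, (2 * X i * X j : MvPolynomial (Fin 3) ℂ).IsHomogeneous 2 :=
    fun i j => by
      rw [← map_ofNat C 2]
      exact (isHomogeneous_C_mul_X _ _).mul (isHomogeneous_X _ _)
  fin_cases m
  exacts [hsq 0, hmul 0 1, hmul 0 2, hsq 1, hmul 1 2, hsq 2]

theorem isHomogeneous_adjugate {σ : Type*} {M : Matrix (Fin 3) (Fin 3) (MvPolynomial σ ℂ)}
    (hM : ∀ p q, (M p q).IsHomogeneous 1) (p q : Fin 3) : (adjugate M p q).IsHomogeneous 2 := by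
  have h : ∀ i j k l, (M i j * M k l).IsHomogeneous 2 := fun i j k l => (hM i j).mul (hM k l)
  rw [adjugate_fin_succ_eq_det_submatrix, det_fin_two]
  simp only [submatrix_apply]
  rcases neg_one_pow_eq_or (MvPolynomial σ ℂ) (q + p : ℕ) with h1 | h1
  · rw [h1, one_mul]
    exact (h _ _ _ _).sub (h _ _ _ _)
  · rw [h1, neg_one_mul]
    exact ((h _ _ _ _).sub (h _ _ _ _)).neg

theorem eval_adjugate_symMatPoly (a : Fin 6 → ℂ) (p q : Fin 3) :
    eval a (adjugate symMatPoly p q) = adjugate (symMat a) p q := by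
  rw [← eval_symMatPoly, ← RingHom.map_adjugate]
  rfl

theorem adjugate_vecMulVec_self (x : Fin 3 → ℂ) : adjugate (vecMulVec x x) = 0 := by
  rw [adjugate_fin_three]
  ext p q
  fin_cases p <;> fin_cases q <;> simp [vecMulVec_apply] <;> ring

theorem exists_monomial_eq_mul_nuPoly {d : Fin 3 →₀ ℕ} (hd : d.degree = 3) :
    ∃ (l : Fin 3) (m : Fin 6) (c : ℂ),
      (monomial d 1 : MvPolynomial (Fin 3) ℂ) = c • (X l * nuPoly m) := by
  obtain ⟨e, l, rfl, he⟩ := exists_eq_add_single_of_degree_eq_succ hd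
  obtain ⟨e', i, rfl, he'⟩ := exists_eq_add_single_of_degree_eq_succ he
  obtain ⟨e'', j, rfl, he''⟩ := exists_eq_add_single_of_degree_eq_succ he'
  rw [Finsupp.degree_eq_zero_iff] at he''
  have key : ∀ i j : Fin 3, ∃ (m : Fin 6) (c : ℂ),
      (X j * X i : MvPolynomial (Fin 3) ℂ) = c • nuPoly m := fun i j => by
    have hc : ∀ (i j : Fin 3) (m : Fin 6) (c : ℂ), (∀ x : Fin 3 → ℂ, x j * x i = c * nu x m) →
        ∃ (m : Fin 6) (c : ℂ), (X j * X i : MvPolynomial (Fin 3) ℂ) = c • nuPoly m :=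
      fun i j m c h => ⟨m, c, MvPolynomial.funext fun x => by simp [smul_eval, eval_nuPoly, h]⟩
    fin_cases i <;> fin_cases j
    · exact hc 0 0 0 1 fun x => by simp [nu]; ring
    · exact hc 0 1 1 2⁻¹ fun x => by simp [nu]; ring
    · exact hc 0 2 2 2⁻¹ fun x => by simp [nu]; ring
    · exact hc 1 0 1 2⁻¹ fun x => by simp [nu]; ring
    · exact hc 1 1 3 1 fun x => by simp [nu]; ring
    · exact hc 1 2 4 2⁻¹ fun x => by simp [nu]; ring
    · exact hc 2 0 2 2⁻¹ fun x => by simp [nu]; ring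
    · exact hc 2 1 4 2⁻¹ fun x => by simp [nu]; ring
    · exact hc 2 2 5 1 fun x => by simp [nu]; ring
  obtain ⟨m, c, hm⟩ := key i j
  refine ⟨l, m, c, ?_⟩
  rw [mul_comm, ← smul_mul_assoc, ← hm, he'', zero_add, X, X, X, monomial_mul, monomial_mul,
    one_mul, one_mul]

theorem isRigidFamily_of_apolarForm {g : MvPolynomial (Fin 3) ℂ}
    (hg : (catalecticant g).det ≠ 0) {a : Fin 9 → Fin 6 → ℂ}
    (h : ∀ k : MvPolynomial (Fin 6) ℂ, k.IsHomogeneous 3 →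
      ∑ i, apolarForm (linForm (a i) ^ 3) k = apolarForm g (aeval nuPoly k)) :
    IsRigidFamily a := by
  have hsum : ∀ k : MvPolynomial (Fin 6) ℂ, k.IsHomogeneous 3 →
      6 * ∑ i, eval (a i) k = apolarForm g (aeval nuPoly k) := fun k hk => by
    rw [← h k hk, Finset.mul_sum]
    refine Finset.sum_congr rfl fun i _ => ?_
    rw [apolarForm_linForm_pow _ hk]
    norm_num [Nat.factorial]
  refine ⟨fun β => ?_, fun θ hθ v => ?_⟩
  · have hentry : ∀ p q, ∑ i, adjugate (symMat (a i)) p q • a i = 0 := fun p q => by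
      ext m
      have h1 := hsum (adjugate symMatPoly p q * X m)
        ((isHomogeneous_adjugate isHomogeneous_symMatPoly p q).mul (isHomogeneous_X _ _))
      have h2 : aeval nuPoly (adjugate symMatPoly p q * X m) = 0 :=
        MvPolynomial.funext fun x => by
          rw [eval_aeval_nuPoly, map_mul, eval_adjugate_symMatPoly, symMat_nu,
            adjugate_vecMulVec_self, Matrix.zero_apply, zero_mul, map_zero]
      rw [h2, map_zero] at h1
      have h3 := (mul_eq_zero.1 h1).resolve_left (by norm_num)
      simpa [eval_adjugate_symMatPoly, Finset.sum_apply] using h3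
    have hβ : ∀ M : Matrix (Fin 3) (Fin 3) ℂ, β M = ∑ p, ∑ q, β (single p q 1) * M p q :=
      fun M => by
        conv_lhs => rw [matrix_eq_sum_single M]
        simp only [map_sum]
        refine Finset.sum_congr rfl fun p _ => Finset.sum_congr rfl fun q _ => ?_
        have h1 : single p q (M p q) = M p q • single p q 1 := by
          rw [smul_single, smul_eq_mul, mul_one]
        rw [h1, map_smul, smul_eq_mul, mul_comm]
    simp only [fun i => hβ (adjugate (symMat (a i))), Finset.sum_smul, mul_smul]
    rw [Finset.sum_comm]
    refine Finset.sum_eq_zero fun p _ => ?_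
    rw [Finset.sum_comm]
    refine Finset.sum_eq_zero fun q _ => ?_
    rw [← Finset.smul_sum, hentry, smul_zero]
  · have hθm : ∀ x p, θ x p = ∑ m, x m * θ (Pi.single m 1) p := fun x p => by
      conv_lhs => rw [pi_eq_sum_univ' x]
      simp [Finset.sum_apply]
    let T : Fin 3 → MvPolynomial (Fin 6) ℂ := fun p => ∑ m, C (θ (Pi.single m 1) p) * X m
    have hT : ∀ x p, eval x (T p) = θ x p := fun x p => by
      rw [hθm]
      simp [T, mul_comm]
    have hThom : ∀ p, (T p).IsHomogeneous 1 := fun p =>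
      IsHomogeneous.sum _ _ _ fun m _ => isHomogeneous_C_mul_X _ _
    let c : MvPolynomial (Fin 3) ℂ := ∑ p, X p * aeval nuPoly (T p)
    have hc : ∀ x, eval x c = x ⬝ᵥ θ (nu x) := fun x => by
      simp only [c, map_sum, map_mul, eval_X, eval_aeval_nuPoly, hT, dotProduct]
    have hchom : c.IsHomogeneous 3 := IsHomogeneous.sum _ _ _ fun p _ => by
      refine (isHomogeneous_X ℂ p).mul (n := 2) ?_
      simpa using (hThom p).aeval nuPoly isHomogeneous_nuPoly
    have hc0 : c = 0 := eq_zero_of_apolarForm_mul_eq_zero hg hchom fun d hd => by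
      obtain ⟨l, m, r, hr⟩ := exists_monomial_eq_mul_nuPoly hd
      have h1 := hsum (X m * ∑ p, symMatPoly l p * T p)
        ((isHomogeneous_X ℂ m).mul (n := 2) (IsHomogeneous.sum _ _ _ fun p _ =>
          (isHomogeneous_symMatPoly l p).mul (hThom p)))
      have hev : ∀ x, eval x (X m * ∑ p, symMatPoly l p * T p) =
          x m * (symMat x *ᵥ θ x) l := fun x => by
        rw [← eval_symMatPoly]
        simp [mulVec, dotProduct, hT]
      have h2 : aeval nuPoly (X m * ∑ p, symMatPoly l p * T p) = X l * nuPoly m * c :=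
        MvPolynomial.funext fun x => by
          rw [eval_aeval_nuPoly, hev, symMat_nu, vecMulVec_mulVec, op_smul_eq_smul, map_mul,
            map_mul, hc, eval_X, eval_nuPoly, Pi.smul_apply, smul_eq_mul]
          ring
      have h3 : ∑ i, eval (a i) (X m * ∑ p, symMatPoly l p * T p) = 0 := by
        simpa [hev, Finset.sum_apply] using congrFun (hθ m) l
      rw [h2, h3, mul_zero] at h1
      rw [hr, smul_mul_assoc, map_smul, ← h1, smul_zero]
    rw [← hc, hc0, map_zero]

/-- **Consequence of Proposition (lefiniteveronese), (i).** A general cubic fourfold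
apolar to a Veronese surface is not a sum of 9 cubes of linear forms. -/
theorem statement14 :
    ∃ P : MvPolynomial ((Fin 3) →₀ ℕ) ℂ,
      (∃ g₀ : MvPolynomial (Fin 3) ℂ, g₀.IsHomogeneous 6 ∧ evalCoeff g₀ P ≠ 0) ∧
      ∀ g : MvPolynomial (Fin 3) ℂ, g.IsHomogeneous 6 → evalCoeff g P ≠ 0 →
        ∀ s : MvPolynomial (Fin 3) ℂ →ₗ[ℂ] MvPolynomial (Fin 6) ℂ, IsSMap s →
          ¬ ∃ a : Fin 9 → (Fin 6 → ℂ), s g = ∑ i, linForm (a i) ^ 3 := by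
  refine ⟨catalecticantDet, ?_, ?_⟩
  · obtain ⟨g, hg, hdet⟩ := exists_catalecticant_det_ne_zero
    exact ⟨g, hg, by rwa [evalCoeff_catalecticantDet]⟩
  · rintro g hg hdet s ⟨-, hs⟩ ⟨a, ha⟩
    rw [evalCoeff_catalecticantDet] at hdet
    refine not_isRigidFamily a (isRigidFamily_of_apolarForm hdet fun k hk => ?_)
    rw [← apolarForm_sum, ← ha, ← pairing_eq_apolarForm, hs g k hg hk, pairing_eq_apolarForm]
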